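/- (Nondefectivity for low-rank Gaussian moment varieties.) Let n ≥ 1, d ≥ 3 and r ≤ n. Let GM_{d,r}(ℂ^n) ⊆ S^d_n be the Zariski closure of {s_d(ℓ, q) : ℓ ∈ S^1_n, q ∈ S^2_n, rank (Hessian q) ≤ r}, and set M_r := (r+1)*n − r*(r−1)/2. Then dim GM_{d,r}(ℂ^n) is a natural number N with N ≤ M_r; for every m ≥ 1 with N * (m + N) ≤ choose (n+d−1) d, the m-th secant variety σ_m GM_{d,r}(ℂ^n) has dimension exactly m * N; and for every m ≥ 1 with m * N ≥ choose (n+d−1) d + N^2, σ_m GM_{d,r}(ℂ^n) equals all of S^d_n. -/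

import Mathlib

noncomputable section

open MvPolynomial

/-- The Zariski topology on a `ℂ`-vector space `M` (for finite-dimensional `M`,
identified with a coordinate space via a basis, this is the topology in which a set
is closed iff it is the common zero locus of a family of polynomial functions
of the coordinates). -/
def ztV (M : Type*) [AddCommGroup M] [Module ℂ M] : TopologicalSpace M :=
  TopologicalSpace.generateFrom
    { U | ∃ (k : ℕ) (p : MvPolynomial (Fin k) ℂ) (L : Fin k → M →ₗ[ℂ] ℂ),
        U = { x | MvPolynomial.eval (fun i => L i x) p ≠ 0 } }

def zIsOpenV {M : Type*} [AddCommGroup M] [Module ℂ M] (S : Set M) : Prop :=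
  @IsOpen _ (ztV M) S

def zClosureV {M : Type*} [AddCommGroup M] [Module ℂ M] (S : Set M) : Set M :=
  @closure _ (ztV M) S

/-- The topological Krull dimension of `S` (with the subspace Zariski topology):
the supremum of lengths of chains of irreducible closed subsets. -/
def zDimV {M : Type*} [AddCommGroup M] [Module ℂ M] (S : Set M) : WithBot ℕ∞ :=
  @topologicalKrullDim ↥S (TopologicalSpace.induced Subtype.val (ztV M))

/-- The `m`-th secant variety: the Zariski closure of the set of sums of `m` points of `V`. -/
def secantV {M : Type*} [AddCommGroup M] [Module ℂ M] (m : ℕ) (V : Set M) : Set M :=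
  zClosureV { p | ∃ x : Fin m → M, (∀ i, x i ∈ V) ∧ p = ∑ i, x i }

/-- `V` is `m`-identifiable: there is a dense open subset `O` of `σ_m V` such that every
`p ∈ O` is a sum of `m` points of `V`, uniquely up to a permutation of the summands. -/
def IsIdentifiableV {M : Type*} [AddCommGroup M] [Module ℂ M] (m : ℕ) (V : Set M) : Prop :=
  ∃ O : Set M, O ⊆ secantV m V ∧
    (∃ U, zIsOpenV U ∧ O = U ∩ secantV m V) ∧
    secantV m V ⊆ zClosureV O ∧
    ∀ p ∈ O,
      (∃ x : Fin m → M, (∀ i, x i ∈ V) ∧ p = ∑ i, x i) ∧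
      ∀ x y : Fin m → M, (∀ i, x i ∈ V) → (∀ i, y i ∈ V) →
        p = ∑ i, x i → p = ∑ i, y i →
          ∃ e : Equiv.Perm (Fin m), ∀ i, y i = x (e i)

/-- The degree-`d` homogeneous component of `exp(ℓ + q/2)`:
`s_d(ℓ, q) = ∑_{j=0}^{⌊d/2⌋} (1 / (2^j j! (d-2j)!)) • ℓ^(d-2j) q^j`. -/
def sMoment (n d : ℕ) (ℓ q : MvPolynomial (Fin n) ℂ) : MvPolynomial (Fin n) ℂ :=
  ∑ j ∈ Finset.range (d / 2 + 1),
    ((1 : ℂ) / ((2 ^ j * Nat.factorial j * Nat.factorial (d - 2 * j) : ℕ) : ℂ)) •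
      (ℓ ^ (d - 2 * j) * q ^ j)

/-- The Hessian matrix of a quadratic form `q`: the constant matrix with entries the
constant polynomials `pderiv i (pderiv j q)`. -/
def hessian (n : ℕ) (q : MvPolynomial (Fin n) ℂ) : Matrix (Fin n) (Fin n) ℂ :=
  Matrix.of fun i j => MvPolynomial.eval (0 : Fin n → ℂ)
    (MvPolynomial.pderiv i (MvPolynomial.pderiv j q))

/-- The rank-`r` Gaussian moment variety: the Zariski closure in `S^d_n` of the set of
all `s_d(ℓ, q)` with `ℓ` linear, `q` quadratic of Hessian rank at most `r`. -/
def GMVarietyRank (n d r : ℕ) : Set ↥(homogeneousSubmodule (Fin n) ℂ d) :=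
  zClosureV { f | ∃ ℓ q : MvPolynomial (Fin n) ℂ,
    ℓ ∈ homogeneousSubmodule (Fin n) ℂ 1 ∧ q ∈ homogeneousSubmodule (Fin n) ℂ 2 ∧
    (hessian n q).rank ≤ r ∧
    (f : MvPolynomial (Fin n) ℂ) = sMoment n d ℓ q }

/-! ### Generic points of affine space -/

/-- The filter of generic subsets of the affine space `σ → ℂ`: those containing the complement of
a hypersurface. -/
def genericFilter (σ : Type*) : Filter (σ → ℂ) where
  sets := {s | ∃ F : MvPolynomial σ ℂ, F ≠ 0 ∧ ∀ x, eval x F ≠ 0 → x ∈ s}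
  univ_sets := ⟨1, one_ne_zero, fun _ _ => trivial⟩
  sets_of_superset := fun ⟨F, hF, h⟩ hst => ⟨F, hF, fun x hx => hst (h x hx)⟩
  inter_sets := fun ⟨F, hF, h⟩ ⟨G, hG, h'⟩ => ⟨F * G, mul_ne_zero hF hG, fun x hx => by
    rw [map_mul] at hx
    exact ⟨h x (left_ne_zero_of_mul hx), h' x (right_ne_zero_of_mul hx)⟩⟩

theorem eventually_genericFilter {σ : Type*} {P : (σ → ℂ) → Prop} :
    (∀ᶠ x in genericFilter σ, P x) ↔
      ∃ F : MvPolynomial σ ℂ, F ≠ 0 ∧ ∀ x, eval x F ≠ 0 → P x :=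
  Iff.rfl

theorem exists_eval_ne_zero {σ : Type*} {F : MvPolynomial σ ℂ} (hF : F ≠ 0) :
    ∃ x, eval x F ≠ 0 := by
  by_contra! h
  exact hF (MvPolynomial.funext fun x => by simpa using h x)

instance genericFilter_neBot (σ : Type*) : (genericFilter σ).NeBot := by
  refine Filter.neBot_iff.2 fun h => ?_
  have : ∀ᶠ _ in genericFilter σ, False := by simp [h]
  obtain ⟨F, hF, h⟩ := eventually_genericFilter.1 this
  obtain ⟨x, hx⟩ := exists_eval_ne_zero hF
  exact h x hx

theorem eventually_genericFilter_of_eval_ne_zero {σ : Type*} {F : MvPolynomial σ ℂ}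
    {x₀ : σ → ℂ} (h : eval x₀ F ≠ 0) : ∀ᶠ x in genericFilter σ, eval x F ≠ 0 :=
  eventually_genericFilter.2 ⟨F, by rintro rfl; simp at h, fun _ => id⟩

/-- A polynomial vanishing at generic points is zero. -/
theorem eq_zero_of_eventually_eval_eq_zero {σ : Type*} {F : MvPolynomial σ ℂ}
    (h : ∀ᶠ x in genericFilter σ, eval x F = 0) : F = 0 := by
  by_contra hF
  have h' : ∀ᶠ x in genericFilter σ, eval x F ≠ 0 :=
    eventually_genericFilter.2 ⟨F, hF, fun _ => id⟩
  obtain ⟨x, hx, hx'⟩ := (h.and h').exists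
  exact hx' hx

theorem eval_aeval {σ σ' : Type*} (A : σ' → MvPolynomial σ ℂ) (F : MvPolynomial σ' ℂ)
    (x : σ → ℂ) : eval x (aeval A F) = eval (fun j => eval x (A j)) F := by
  induction F using MvPolynomial.induction_on with
  | C a => simp
  | add p q hp hq => simp only [map_add, hp, hq]
  | mul_X p i hp => simp only [map_mul, hp, aeval_X, eval_X]

/-- Surjective polynomial maps send generic points to generic points. -/
theorem tendsto_genericFilter {σ σ' : Type*} (A : σ' → MvPolynomial σ ℂ)
    (hA : Function.Surjective fun (x : σ → ℂ) j => eval x (A j)) :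
    Filter.Tendsto (fun (x : σ → ℂ) j => eval x (A j)) (genericFilter σ) (genericFilter σ') := by
  rintro s ⟨F, hF, hs⟩
  refine ⟨aeval A F, ?_, fun x hx => hs _ (by rwa [eval_aeval] at hx)⟩
  obtain ⟨y, hy⟩ := exists_eval_ne_zero hF
  obtain ⟨x, rfl⟩ := hA y
  rintro h
  rw [← eval_aeval, h] at hy
  simp at hy

/-- Freezing some of the coordinates of a generic point leaves the others generic. -/
theorem exists_eventually_genericFilter_ite {σ : Type*} (p : σ → Prop) [DecidablePred p]
    {P : (σ → ℂ) → Prop} (h : ∀ᶠ x in genericFilter σ, P x) :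
    ∃ x₀ : σ → ℂ, ∀ᶠ x in genericFilter σ, P fun j => if p j then x₀ j else x j := by
  obtain ⟨F, hF, h⟩ := eventually_genericFilter.1 h
  obtain ⟨x₀, hx₀⟩ := exists_eval_ne_zero hF
  let A : σ → MvPolynomial σ ℂ := fun j => if p j then C (x₀ j) else X j
  have hA : ∀ x : σ → ℂ, (fun j => eval x (A j)) = fun j => if p j then x₀ j else x j := by
    intro x
    funext j
    by_cases hj : p j <;> simp [A, hj]
  refine ⟨x₀, eventually_genericFilter.2 ⟨aeval A F, ?_, fun x hx => h _ ?_⟩⟩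
  · intro h0
    have : eval x₀ (aeval A F) = 0 := by rw [h0, map_zero]
    rw [eval_aeval, hA] at this
    exact hx₀ (by simpa using this)
  · rwa [eval_aeval, hA] at hx

/-! ### Jacobians of polynomial maps -/

section Jacobian

variable {τ B : Type*} [Fintype τ]

/-- The differential at `θ` of the polynomial map with components `f`. -/
def jacobianAt (f : B → MvPolynomial τ ℂ) (θ : τ → ℂ) : (τ → ℂ) →ₗ[ℂ] (B → ℂ) :=
  Matrix.mulVecLin (Matrix.of fun b t => eval θ (pderiv t (f b)))

theorem jacobianAt_apply (f : B → MvPolynomial τ ℂ) (θ u : τ → ℂ) (b : B) :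
    jacobianAt f θ u b = ∑ t, eval θ (pderiv t (f b)) * u t := rfl

theorem hasFDerivAt_eval (F : MvPolynomial τ ℂ) (x : τ → ℂ) :
    HasFDerivAt (fun x => eval x F)
      (∑ t, eval x (pderiv t F) • (ContinuousLinearMap.proj t : (τ → ℂ) →L[ℂ] ℂ)) x := by
  classical
  induction F using MvPolynomial.induction_on with
  | C a =>
    simp only [eval_C]
    exact (hasFDerivAt_const (𝕜 := ℂ) a x).congr_fderiv (by ext; simp)
  | add p q hp hq =>
    simp only [map_add]
    refine (hp.add hq).congr_fderiv ?_
    ext u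
    simp [add_mul, Finset.sum_add_distrib]
  | mul_X p i hp =>
    have := hp.mul (hasFDerivAt_apply (𝕜 := ℂ) i x)
    simp only [map_mul, eval_X]
    refine this.congr_fderiv ?_
    ext u
    simp [Derivation.leibniz, pderiv_X, Finset.sum_add_distrib, add_mul, Pi.single_apply,
      Finset.mul_sum, mul_assoc, apply_ite]

theorem hasFDerivAt_eval_pi [Fintype B] (f : B → MvPolynomial τ ℂ) (x : τ → ℂ) :
    HasFDerivAt (fun x b => eval x (f b)) (LinearMap.toContinuousLinearMap (jacobianAt f x)) x := by
  rw [hasFDerivAt_pi']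
  intro b
  refine (hasFDerivAt_eval (f b) x).congr_fderiv ?_
  ext u
  simp [jacobianAt_apply]

theorem jacobianAt_aeval [Fintype B] {ι : Type*} [Fintype ι] (f : B → MvPolynomial τ ℂ)
    (H : ι → MvPolynomial B ℂ) (θ : τ → ℂ) :
    jacobianAt (fun i => aeval f (H i)) θ =
      jacobianAt H (fun b => eval θ (f b)) ∘ₗ jacobianAt f θ := by
  have h₁ := hasFDerivAt_eval_pi (fun i => aeval f (H i)) θ
  have h₂ := (hasFDerivAt_eval_pi H (fun b => eval θ (f b))).comp θ (hasFDerivAt_eval_pi f θ)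
  simp only [eval_aeval] at h₁
  have := h₁.unique h₂
  exact LinearMap.toContinuousLinearMap.injective (this.trans (by ext; simp))

/-- The generic rank of the differential of a polynomial map. -/
def genericRank (f : B → MvPolynomial τ ℂ) : ℕ :=
  ⨆ θ, Module.finrank ℂ (LinearMap.range (jacobianAt f θ))

theorem bddAbove_finrank_range_jacobianAt (f : B → MvPolynomial τ ℂ) :
    BddAbove (Set.range fun θ => Module.finrank ℂ (LinearMap.range (jacobianAt f θ))) :=
  ⟨Fintype.card τ, by
    rintro _ ⟨θ, rfl⟩
    simpa using LinearMap.finrank_range_le (jacobianAt f θ)⟩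

theorem finrank_range_jacobianAt_le (f : B → MvPolynomial τ ℂ) (θ : τ → ℂ) :
    Module.finrank ℂ (LinearMap.range (jacobianAt f θ)) ≤ genericRank f :=
  le_ciSup (bddAbove_finrank_range_jacobianAt f) θ

theorem exists_finrank_range_jacobianAt_eq (f : B → MvPolynomial τ ℂ) :
    ∃ θ, Module.finrank ℂ (LinearMap.range (jacobianAt f θ)) = genericRank f :=
  Nat.sSup_mem (Set.range_nonempty _) (bddAbove_finrank_range_jacobianAt f)

theorem exists_comp_comp_eq_id {V W : Type*} [AddCommGroup V] [Module ℂ V] [AddCommGroup W]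
    [Module ℂ W] [FiniteDimensional ℂ V] (J : V →ₗ[ℂ] W) :
    ∃ (a : (Fin (Module.finrank ℂ (LinearMap.range J)) → ℂ) →ₗ[ℂ] V)
      (b : W →ₗ[ℂ] (Fin (Module.finrank ℂ (LinearMap.range J)) → ℂ)),
      b ∘ₗ J ∘ₗ a = LinearMap.id := by
  let e := (Module.finBasis ℂ (LinearMap.range J)).equivFun
  obtain ⟨s, hs⟩ := J.rangeRestrict.exists_rightInverse_of_surjective J.range_rangeRestrict
  obtain ⟨p, hp⟩ := (LinearMap.range J).subtype.exists_leftInverse_of_injective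
    (LinearMap.range J).ker_subtype
  refine ⟨s ∘ₗ e.symm.toLinearMap, e.toLinearMap ∘ₗ p, LinearMap.ext fun v => ?_⟩
  have h₁ : J (s (e.symm v)) = (LinearMap.range J).subtype (e.symm v) := by
    have := LinearMap.congr_fun hs (e.symm v)
    exact congrArg Subtype.val this
  have h₂ := LinearMap.congr_fun hp (e.symm v)
  simp only [LinearMap.comp_apply] at h₂ ⊢
  simp only [LinearEquiv.coe_coe, h₁, h₂, LinearMap.id_apply, LinearEquiv.apply_symm_apply]

theorem eventually_finrank_range_jacobianAt [Fintype B] (f : B → MvPolynomial τ ℂ) :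
    ∀ᶠ θ in genericFilter τ,
      Module.finrank ℂ (LinearMap.range (jacobianAt f θ)) = genericRank f := by
  classical
  obtain ⟨θ₀, h₀⟩ := exists_finrank_range_jacobianAt_eq f
  obtain ⟨a, b, hab⟩ := exists_comp_comp_eq_id (jacobianAt f θ₀)
  let P : Matrix (Fin _) (Fin _) (MvPolynomial τ ℂ) :=
    (LinearMap.toMatrix' b).map (C : ℂ → MvPolynomial τ ℂ) *
      (Matrix.of fun i t => pderiv t (f i) : Matrix B τ (MvPolynomial τ ℂ)) *
      (LinearMap.toMatrix' a).map (C : ℂ → MvPolynomial τ ℂ)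
  have hP : ∀ θ, eval θ P.det = LinearMap.det (b ∘ₗ jacobianAt f θ ∘ₗ a) := by
    intro θ
    rw [← LinearMap.det_toMatrix', LinearMap.toMatrix'_comp, LinearMap.toMatrix'_comp,
      RingHom.map_det, ← Matrix.mul_assoc]
    congr 1
    simp only [P, RingHom.mapMatrix_apply, Matrix.map_mul]
    congr 1
    · congr 1
      · ext; simp
      · ext; simp [jacobianAt]
    · ext; simp
  have hne : eval θ₀ P.det ≠ 0 := by simp [hP, hab]
  filter_upwards [eventually_genericFilter_of_eval_ne_zero hne] with θ hθ
  refine le_antisymm (finrank_range_jacobianAt_le f θ) ?_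
  rw [hP] at hθ
  have hsurj := (LinearMap.equivOfDetNeZero _ hθ).surjective
  have hle : (⊤ : Submodule ℂ (Fin _ → ℂ)) ≤ (LinearMap.range (jacobianAt f θ)).map b := by
    intro v _
    obtain ⟨w, hw⟩ := hsurj v
    exact ⟨jacobianAt f θ (a w), ⟨a w, rfl⟩, hw⟩
  have h₁ := (Submodule.finrank_mono hle).trans (Submodule.finrank_map_le b _)
  simpa [h₀] using h₁

end Jacobian

/-! ### The Jacobian criterion and the dimension of the image -/

theorem eq_C_of_pderiv_eq_zero {ι : Type*} (F : MvPolynomial ι ℂ) (h : ∀ i, pderiv i F = 0) :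
    F = C (coeff 0 F) := by
  classical
  ext m
  rw [coeff_C]
  split_ifs with hm
  · rw [← hm]
  · obtain ⟨i, hi⟩ : ∃ i, m i ≠ 0 := by
      by_contra! h0
      exact hm (Finsupp.ext fun i => by simpa using (h0 i).symm)
    have h1 := coeff_pderiv (i := i) F (m - Finsupp.single i 1)
    have h2 : m - Finsupp.single i 1 + Finsupp.single i 1 = m :=
      tsub_add_cancel_of_le (by simpa [Finsupp.single_le_iff] using Nat.one_le_iff_ne_zero.2 hi)
    rw [h, coeff_zero, h2] at h1
    have h3 : ((((m - Finsupp.single i 1 : ι →₀ ℕ) i : ℕ)) : ℂ) + 1 ≠ 0 :=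
      Nat.cast_add_one_ne_zero _
    rcases mul_eq_zero.1 h1.symm with h | h
    · exact h
    · exact absurd h h3

theorem totalDegree_pderiv_le {ι : Type*} (F : MvPolynomial ι ℂ) (i : ι) {k : ℕ}
    (hF : F.totalDegree ≤ k + 1) : (pderiv i F).totalDegree ≤ k := by
  classical
  refine Finset.sup_le fun m hm => ?_
  have hm' : coeff (m + Finsupp.single i 1) F ≠ 0 := by
    intro h
    rw [mem_support_iff, coeff_pderiv, h, zero_mul] at hm
    exact hm rfl
  have := (le_totalDegree (mem_support_iff.2 hm')).trans hF
  rw [Finsupp.sum_add_index' (fun _ => rfl) (fun _ _ _ => rfl),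
    Finsupp.sum_single_index rfl] at this
  omega

section Criterion

variable {τ : Type*} [Fintype τ]

theorem algebraicIndependent_of_jacobianAt_surjective {ι : Type*} [Fintype ι]
    (c : ι → MvPolynomial τ ℂ) (θ₀ : τ → ℂ) (h : Function.Surjective (jacobianAt c θ₀)) :
    AlgebraicIndependent ℂ c := by
  classical
  have hrank : genericRank c = Fintype.card ι := by
    refine le_antisymm ?_ ?_
    · obtain ⟨θ, hθ⟩ := exists_finrank_range_jacobianAt_eq c
      rw [← hθ]
      simpa using Submodule.finrank_le (LinearMap.range (jacobianAt c θ))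
    · have := finrank_range_jacobianAt_le c θ₀
      rw [LinearMap.range_eq_top.2 h] at this
      simpa using this
  have key : ∀ (k : ℕ) (F : MvPolynomial ι ℂ), F.totalDegree ≤ k → aeval c F = 0 → F = 0 := by
    have hconst : ∀ F : MvPolynomial ι ℂ, aeval c F = 0 → F = C (coeff 0 F) → F = 0 := by
      intro F hF hC
      rw [hC, aeval_C, algebraMap_eq, C_eq_zero] at hF
      rw [hC, hF, C_0]
    intro k
    induction k with
    | zero =>
      intro F hk hF
      exact hconst F hF (totalDegree_eq_zero_iff_eq_C.1 (Nat.le_zero.1 hk))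
    | succ k ih =>
      intro F hk hF
      refine hconst F hF (eq_C_of_pderiv_eq_zero F fun i => ih _ (totalDegree_pderiv_le F i hk) ?_)
      refine eq_zero_of_eventually_eval_eq_zero ?_
      filter_upwards [eventually_finrank_range_jacobianAt c] with θ hθ
      have htop : LinearMap.range (jacobianAt c θ) = ⊤ :=
        Submodule.eq_top_of_finrank_eq (by rw [hθ, hrank]; simp)
      obtain ⟨u, hu⟩ := LinearMap.range_eq_top.1 htop (Pi.single i 1)
      have h1 := LinearMap.congr_fun (jacobianAt_aeval c (fun _ : Unit => F) θ) u
      have h2 := congrFun h1 ()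
      rw [LinearMap.comp_apply, hu, jacobianAt_apply, jacobianAt_apply] at h2
      simp only [hF, map_zero, zero_mul, Finset.sum_const_zero] at h2
      rw [eval_aeval]
      simpa [Pi.single_apply] using h2.symm
  exact (injective_iff_map_eq_zero _).2 fun F hF => key _ F le_rfl hF

theorem derivation_eq_zero_of_isAlgebraic {A K : Type*} [CommRing A] [IsDomain A] [Algebra ℂ A]
    [Field K] [Algebra A K] [FaithfulSMul A K] [Algebra ℂ K] [IsScalarTower ℂ A K]
    (D : Derivation ℂ A K) (s : Set A) (hs : ∀ a ∈ s, D a = 0)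
    [halg : Algebra.IsAlgebraic (Algebra.adjoin ℂ s) A] : D = 0 := by
  classical
  have hB : ∀ b : Algebra.adjoin ℂ s, D (b : A) = 0 := fun b =>
    Derivation.eqOn_adjoin (D2 := 0) (fun a ha => hs a ha) b.2
  let D' : Derivation (Algebra.adjoin ℂ s) A K :=
    { toFun := D
      map_add' := D.map_add
      map_smul' := fun b x => by
        change D ((b : A) * x) = (b : A) • D x
        rw [D.leibniz, hB b, smul_zero, add_zero]
      map_one_eq_zero' := D.map_one_eq_zero
      leibniz' := D.leibniz }
  ext x
  have hx : ∃ k, ∃ p : Polynomial (Algebra.adjoin ℂ s),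
      p.natDegree = k ∧ p ≠ 0 ∧ Polynomial.aeval x p = 0 := by
    obtain ⟨p, hp, hpx⟩ := halg.isAlgebraic x
    exact ⟨_, p, rfl, hp, hpx⟩
  obtain ⟨p, hk, hp, hpx⟩ := Nat.find_spec hx
  have hmin := fun k => Nat.find_min hx (m := k)
  have hdeg : p.natDegree ≠ 0 := by
    intro h0
    rw [Polynomial.eq_C_of_natDegree_eq_zero h0, Polynomial.aeval_C] at hpx
    rw [Polynomial.eq_C_of_natDegree_eq_zero h0] at hp
    have : (p.coeff 0) = 0 := by
      apply Subtype.ext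
      simpa [Subalgebra.algebraMap_def] using hpx
    exact hp (by rw [this, Polynomial.C_0])
  have hder : Polynomial.aeval x (Polynomial.derivative p) ≠ 0 := by
    intro h0
    have hlt := Polynomial.natDegree_derivative_lt hdeg
    refine hmin _ (hk ▸ hlt) ⟨_, rfl, fun h => hdeg ?_, h0⟩
    have : IsAddTorsionFree (Algebra.adjoin ℂ s) := IsAddTorsionFree.of_isTorsionFree ℂ _
    exact Polynomial.derivative_eq_zero.1 h
  have h1 : D' (Polynomial.aeval x p) = Polynomial.aeval x (Polynomial.derivative p) • D' x :=
    Derivation.map_aeval D' p x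
  rw [hpx, map_zero, eq_comm, Algebra.smul_def, mul_eq_zero] at h1
  rcases h1 with h1 | h1
  · exact absurd ((map_eq_zero_iff _ (FaithfulSMul.algebraMap_injective A K)).1 h1) hder
  · exact h1

theorem exists_jacobianAt_surjective_of_algebraicIndependent {ι : Type*} [Fintype ι]
    (h : ι → MvPolynomial τ ℂ) (hind : AlgebraicIndependent ℂ h) :
    ∃ θ, Function.Surjective (jacobianAt h θ) := by
  classical
  let K := FractionRing (MvPolynomial τ ℂ)
  have halgX : Algebra.IsAlgebraic
      (Algebra.adjoin ℂ (Set.range h ∪ Set.range (X : τ → MvPolynomial τ ℂ)))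
      (MvPolynomial τ ℂ) := by
    refine ⟨fun x => ?_⟩
    have hx : x ∈ Algebra.adjoin ℂ (Set.range h ∪ Set.range (X : τ → MvPolynomial τ ℂ)) :=
      Algebra.adjoin_mono Set.subset_union_right (by rw [adjoin_range_X]; trivial)
    exact isAlgebraic_algebraMap (⟨x, hx⟩ : Algebra.adjoin ℂ _)
  obtain ⟨u, hu, -, hbasis⟩ := exists_isTranscendenceBasis_between (R := ℂ) (Set.range h)
    (Set.range h ∪ Set.range (X : τ → MvPolynomial τ ℂ)) Set.subset_union_left 
    ((algebraicIndependent_subtype_range hind.injective).2 hind)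
  have hcard : Cardinal.lift (Cardinal.mk u) = Cardinal.lift (Cardinal.mk τ) :=
    hbasis.lift_cardinalMk_eq (IsTranscendenceBasis.mvPolynomial τ ℂ)
  have hufin : Finite u := by
    have : Cardinal.mk τ < Cardinal.aleph0 := Cardinal.mk_lt_aleph0
    rw [← Cardinal.lt_aleph0_iff_finite, ← Cardinal.lift_lt_aleph0, hcard, Cardinal.lift_lt_aleph0]
    exact this
  have := Fintype.ofFinite u
  have hcard' : Fintype.card u = Fintype.card τ := by
    simpa using hcard
  have halg : Algebra.IsAlgebraic (Algebra.adjoin ℂ u) (MvPolynomial τ ℂ) := by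
    have := hbasis.isAlgebraic
    rwa [Subtype.range_coe] at this
  let Λ : (τ → K) →ₗ[K] (u → K) := Matrix.mulVecLin
    (Matrix.of fun w t => algebraMap (MvPolynomial τ ℂ) K (pderiv t (w : MvPolynomial τ ℂ)))
  have hΛ : ∀ (c : τ → K) (p : MvPolynomial τ ℂ),
      ∑ t, algebraMap (MvPolynomial τ ℂ) K (pderiv t p) * c t = mkDerivation ℂ c p := by
    intro c p
    induction p using MvPolynomial.induction_on with
    | C a => simp
    | add p q hp hq => simp only [map_add, add_mul, Finset.sum_add_distrib, hp, hq]
    | mul_X p i hp =>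
      rw [Derivation.leibniz, ← hp, mkDerivation_X]
      simp only [Derivation.leibniz, pderiv_X, smul_eq_mul, map_add, map_mul, add_mul,
        Finset.sum_add_distrib, Algebra.smul_def, Finset.mul_sum, mul_assoc]
      congr 1
      simp [Pi.single_apply, apply_ite]
  have hinj : Function.Injective Λ := by
    refine (injective_iff_map_eq_zero _).2 fun c hc => ?_
    have hD : mkDerivation ℂ c = 0 := derivation_eq_zero_of_isAlgebraic _ u fun a ha => by
      rw [← hΛ]
      exact congrFun hc ⟨a, ha⟩
    funext t
    have := congrArg (fun D : Derivation ℂ (MvPolynomial τ ℂ) K => D (X t)) hD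
    simpa using this
  have hsurj : Function.Surjective Λ :=
    (LinearMap.injective_iff_surjective_of_finrank_eq_finrank (by simp [hcard'])).1 hinj
  have hCK : ∀ i : ι, ∃ c : τ → K, ∀ j : ι,
      ∑ t, algebraMap (MvPolynomial τ ℂ) K (pderiv t (h j)) * c t = if j = i then 1 else 0 := by
    intro i
    obtain ⟨c, hc⟩ := hsurj fun w => if (w : MvPolynomial τ ℂ) = h i then 1 else 0
    refine ⟨c, fun j => ?_⟩
    have := congrFun hc ⟨h j, hu ⟨j, rfl⟩⟩
    simpa [Λ, Matrix.mulVec, dotProduct, hind.injective.eq_iff] using this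
  choose c hc using hCK
  obtain ⟨q, hq⟩ := IsLocalization.exist_integer_multiples_of_finite
    (nonZeroDivisors (MvPolynomial τ ℂ)) (fun p : ι × τ => c p.1 p.2)
  choose C' hC' using hq
  obtain ⟨θ, hθ⟩ := exists_eval_ne_zero (nonZeroDivisors.coe_ne_zero q)
  have hpoly : ∀ i j, ∑ t, pderiv t (h j) * C' (i, t) =
      if j = i then (q : MvPolynomial τ ℂ) else 0 := by
    intro i j
    apply IsFractionRing.injective (MvPolynomial τ ℂ) K
    have := congrArg (fun z => algebraMap (MvPolynomial τ ℂ) K q * z) (hc i j)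
    rw [Finset.mul_sum] at this
    rw [map_sum]
    refine Eq.trans (Finset.sum_congr rfl fun t _ => ?_) (this.trans ?_)
    · rw [map_mul, hC', Algebra.smul_def]
      ring
    · split_ifs <;> simp
  refine ⟨θ, fun v => ⟨fun t => ∑ i, v i / eval θ (q : MvPolynomial τ ℂ) * eval θ (C' (i, t)), ?_⟩⟩
  funext j
  rw [jacobianAt_apply]
  have : ∀ i, ∑ t, eval θ (pderiv t (h j)) * eval θ (C' (i, t)) =
      if j = i then eval θ (q : MvPolynomial τ ℂ) else 0 := by
    intro i
    have := congrArg (eval θ) (hpoly i j)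
    simpa [apply_ite] using this
  calc _ = ∑ i, v i / eval θ (q : MvPolynomial τ ℂ) *
        ∑ t, eval θ (pderiv t (h j)) * eval θ (C' (i, t)) := by
        simp only [Finset.mul_sum]
        rw [Finset.sum_comm]
        exact Finset.sum_congr rfl fun i _ => Finset.sum_congr rfl fun t _ => by ring
    _ = v j := by simp [this, hθ]

end Criterion

theorem ringKrullDim_eq_of_isIntegral {R S : Type*} [CommRing R] [CommRing S] [IsDomain S]
    [Algebra R S]
    [Algebra.IsIntegral R S] [FaithfulSMul R S] : ringKrullDim S = ringKrullDim R := by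
  refine le_antisymm ?_ ?_
  · refine Order.krullDim_le_of_strictMono (PrimeSpectrum.comap (algebraMap R S)) fun p q hpq => ?_
    exact Ideal.IsIntegral.comap_lt_comap hpq
  · refine iSup_le fun l => ?_
    obtain ⟨P, hP, hPl⟩ := Ideal.exists_ideal_over_prime_of_isIntegral_of_isDomain
      (S := S) l.head.asIdeal (by
        rw [(RingHom.injective_iff_ker_eq_bot _).1 (FaithfulSMul.algebraMap_injective R S)]
        exact bot_le)
    have : P.LiesOver l.head.asIdeal := ⟨hPl.symm⟩
    obtain ⟨L, hL, -⟩ := Ideal.exists_ltSeries_of_hasGoingUp l P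
    rw [← hL]
    exact Order.LTSeries.length_le_krullDim L

section ImageDimension

variable {B τ : Type} [Fintype B] [Fintype τ]

/-- The coordinate ring of the closed image of a polynomial map has Krull dimension the generic
rank of the Jacobian. -/
theorem ringKrullDim_aeval_range (f : B → MvPolynomial τ ℂ) :
    ringKrullDim (aeval f : MvPolynomial B ℂ →ₐ[ℂ] MvPolynomial τ ℂ).range =
      (genericRank f : WithBot ℕ∞) := by
  classical
  let φ : MvPolynomial B ℂ →ₐ[ℂ] MvPolynomial τ ℂ := aeval f
  let A := φ.range
  have : Algebra.FiniteType ℂ A :=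
    Algebra.FiniteType.of_surjective φ.rangeRestrict φ.rangeRestrict_surjective
  obtain ⟨s, g, hg, hgi⟩ := exists_integral_inj_algHom_of_fg ℂ A
  have hdim : ringKrullDim A = s := by
    algebraize [g.toRingHom]
    have : Algebra.IsIntegral (MvPolynomial (Fin s) ℂ) A := ⟨hgi⟩
    have : FaithfulSMul (MvPolynomial (Fin s) ℂ) A :=
      (faithfulSMul_iff_algebraMap_injective _ _).2 hg
    rw [ringKrullDim_eq_of_isIntegral (R := MvPolynomial (Fin s) ℂ),
      MvPolynomial.ringKrullDim_of_isNoetherianRing]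
    simp
  have hindA : AlgebraicIndependent ℂ fun i => g (X i) :=
    (MvPolynomial.algebraicIndependent_X (Fin s) ℂ).map' hg
  change ringKrullDim A = _
  rw [hdim]
  congr 2
  refine le_antisymm ?_ ?_
  · have hind : AlgebraicIndependent ℂ fun i => A.val (g (X i)) :=
      hindA.map' Subtype.val_injective
    choose H hH using fun i => (g (X i)).2
    have hind' : AlgebraicIndependent ℂ fun i => aeval f (H i) := by
      convert hind using 2 with i
      exact hH i
    obtain ⟨θ, hθ⟩ := exists_jacobianAt_surjective_of_algebraicIndependent _ hind'
    rw [jacobianAt_aeval] at hθ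
    refine le_trans ?_ (finrank_range_jacobianAt_le f θ)
    have h2 := LinearMap.finrank_range_le ((jacobianAt H (fun b => eval θ (f b))).domRestrict
      (LinearMap.range (jacobianAt f θ)))
    rw [LinearMap.range_eq_top.2, finrank_top] at h2
    · simpa using h2
    · intro y
      obtain ⟨x, hx⟩ := hθ y
      exact ⟨⟨_, x, rfl⟩, hx⟩
  · obtain ⟨θ, hθ⟩ := exists_finrank_range_jacobianAt_eq f
    obtain ⟨a, b, hab⟩ := exists_comp_comp_eq_id (jacobianAt f θ)
    let H : Fin (Module.finrank ℂ (LinearMap.range (jacobianAt f θ))) → MvPolynomial B ℂ :=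
      fun i => ∑ c, C (b (Pi.single c 1) i) * X c
    have hH : ∀ y, jacobianAt H y = b := by
      intro y
      refine LinearMap.pi_ext' fun c => LinearMap.ext_ring (funext fun i => ?_)
      simp [jacobianAt_apply, H, pderiv_X, Pi.single_apply]
    have hind : AlgebraicIndependent ℂ fun i => aeval f (H i) := by
      refine algebraicIndependent_of_jacobianAt_surjective _ θ ?_
      rw [jacobianAt_aeval, hH]
      exact fun y => ⟨a y, LinearMap.congr_fun hab y⟩
    have hind' : AlgebraicIndependent ℂ fun i => φ.rangeRestrict (H i) :=
      AlgebraicIndependent.of_comp A.val hind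
    have hbasis : IsTranscendenceBasis ℂ fun i => g (X i) := by
      refine isTranscendenceBasis_iff_algebraicIndependent_isAlgebraic.2 ⟨hindA, ⟨fun x => ?_⟩⟩
      have hmem : ∀ p, g p ∈ Algebra.adjoin ℂ (Set.range fun i => g (X i)) := by
        intro p
        have : g = aeval fun i => g (X i) := by ext; simp
        rw [Algebra.adjoin_range_eq_range_aeval, this]
        exact ⟨p, by simp⟩
      obtain ⟨p, hp, hpx⟩ := hgi x
      refine ⟨p.map (g.codRestrict _ hmem).toRingHom, (hp.map _).ne_zero, ?_⟩
      rw [Polynomial.aeval_def, Polynomial.eval₂_map]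
      exact hpx
    have h1 := hind'.cardinalMk_le_trdeg
    rw [← hbasis.cardinalMk_eq_trdeg] at h1
    simpa [hθ] using h1

end ImageDimension

/-! ### Zariski closed sets in coordinates -/

theorem vanishingIdeal_range_eval {B τ : Type*} (f : B → MvPolynomial τ ℂ) :
    vanishingIdeal ℂ (Set.range fun (θ : τ → ℂ) b => eval θ (f b)) =
      RingHom.ker (aeval f : MvPolynomial B ℂ →ₐ[ℂ] MvPolynomial τ ℂ) := by
  ext p
  rw [mem_vanishingIdeal_iff, RingHom.mem_ker, MvPolynomial.funext_iff]
  simp only [Set.forall_mem_range, eval_aeval, map_zero]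
  rfl

section Zariski

variable {B : Type} [Fintype B]

/-- The Krull dimension of a space whose closed sets are the zero loci of polynomials in the
coordinates `c`, when the image of `c` is the zero locus of the ideal `I`. -/
theorem topologicalKrullDim_eq_ringKrullDim {Y : Type*} [TopologicalSpace Y] (c : Y → B → ℂ)
    (hc : ∀ Z : Set Y, IsClosed Z ↔ ∃ J : Ideal (MvPolynomial B ℂ), Z = c ⁻¹' zeroLocus ℂ J)
    (I : Ideal (MvPolynomial B ℂ)) (hI : Set.range c = zeroLocus ℂ I) :
    topologicalKrullDim Y = ringKrullDim (MvPolynomial B ℂ ⧸ I) := by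
  have hzero : ∀ J : Ideal (MvPolynomial B ℂ), I ≤ J →
      c '' (c ⁻¹' zeroLocus ℂ J) = zeroLocus ℂ J := fun J hJ =>
    Set.image_preimage_eq_of_subset (hI ▸ zeroLocus_anti_mono hJ)
  have hclosed : ∀ Z : Set Y, IsClosed Z → c ⁻¹' zeroLocus ℂ (vanishingIdeal ℂ (c '' Z)) = Z := by
    intro Z hZ
    obtain ⟨J, rfl⟩ := (hc Z).1 hZ
    refine Set.Subset.antisymm (Set.preimage_mono (zeroLocus_anti_mono ?_)) ?_
    · exact le_zeroLocus_iff_le_vanishingIdeal.1 (Set.image_preimage_subset _ _)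
    · exact fun y hy => zeroLocus_vanishingIdeal_le _ ⟨y, hy, rfl⟩
  rw [ringKrullDim_quotient, topologicalKrullDim, ← Order.krullDim_orderDual]
  refine Order.krullDim_eq_of_orderIso (OrderIso.symm ?_)
  refine
    { toFun := fun q => OrderDual.toDual ⟨c ⁻¹' zeroLocus ℂ q.1.asIdeal, ?_, (hc _).2 ⟨_, rfl⟩⟩
      invFun := fun Z => ⟨⟨vanishingIdeal ℂ (c '' (OrderDual.ofDual Z).carrier), ?_⟩, ?_⟩
      left_inv := ?_
      right_inv := ?_
      map_rel_iff' := ?_ }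
  · have hq := IsPrime.vanishingIdeal_zeroLocus (K := ℂ) q.1.asIdeal
    have hIq : I ≤ q.1.asIdeal := q.2
    refine ⟨?_, isPreirreducible_iff_isClosed_union_isClosed.2 fun Z₁ Z₂ h₁ h₂ h => ?_⟩
    · rw [Set.nonempty_iff_ne_empty]
      intro h
      have := hzero _ hIq
      rw [h, Set.image_empty] at this
      rw [← this, vanishingIdeal_empty] at hq
      exact q.1.isPrime.ne_top hq.symm
    · obtain ⟨J₁, rfl⟩ := (hc _).1 h₁
      obtain ⟨J₂, rfl⟩ := (hc _).1 h₂
      have : J₁ * J₂ ≤ q.1.asIdeal := by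
        rw [← hq, ← hzero _ hIq, Ideal.mul_le]
        rintro a ha b hb _ ⟨y, hy, rfl⟩
        rw [map_mul]
        rcases h hy with h | h
        · rw [h a ha, zero_mul]
        · rw [h b hb, mul_zero]
      rcases q.1.isPrime.mul_le.1 this with h | h
      · exact Or.inl (Set.preimage_mono (zeroLocus_anti_mono h))
      · exact Or.inr (Set.preimage_mono (zeroLocus_anti_mono h))
  · obtain ⟨Z, hZ, hZ'⟩ := Z
    have hirr := isPreirreducible_iff_isClosed_union_isClosed.1 hZ.2
    refine ⟨?_, fun {a b} hab => ?_⟩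
    · obtain ⟨y, hy⟩ := hZ.1
      intro h
      have := (Ideal.eq_top_iff_one _).1 h (c y) ⟨y, hy, rfl⟩
      simp at this
    · refine (hirr _ _ ((hc _).2 ⟨Ideal.span {a}, rfl⟩) ((hc _).2 ⟨Ideal.span {b}, rfl⟩)
        fun y hy => ?_).imp ?_ ?_
      · have := hab (c y) ⟨y, hy, rfl⟩
        simpa [zeroLocus_span] using this
      all_goals
        rintro h _ ⟨y, hy, rfl⟩
        have := h hy
        rw [zeroLocus_span] at this
        exact this _ rfl
  · change I ≤ _
    rw [← le_zeroLocus_iff_le_vanishingIdeal, ← hI]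
    exact Set.image_subset_range _ _
  · intro q
    refine Subtype.ext (PrimeSpectrum.ext ?_)
    change vanishingIdeal ℂ (c '' (c ⁻¹' zeroLocus ℂ q.1.asIdeal)) = q.1.asIdeal
    rw [hzero _ q.2]
    exact IsPrime.vanishingIdeal_zeroLocus (K := ℂ) q.1.asIdeal
  · rintro ⟨Z, hZ, hZ'⟩
    exact TopologicalSpace.IrreducibleCloseds.ext (hclosed Z hZ')
  · intro q q'
    change c ⁻¹' zeroLocus ℂ q'.1.asIdeal ⊆ c ⁻¹' zeroLocus ℂ q.1.asIdeal ↔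
      q.1.asIdeal ≤ q'.1.asIdeal
    refine ⟨fun h => ?_, fun h => Set.preimage_mono (zeroLocus_anti_mono h)⟩
    have := vanishingIdeal_anti_mono (k := ℂ) (Set.image_mono (f := c) h)
    rw [hzero _ q.2, hzero _ q'.2, IsPrime.vanishingIdeal_zeroLocus,
      IsPrime.vanishingIdeal_zeroLocus] at this
    exact this

variable {M : Type*} [AddCommGroup M] [Module ℂ M]

theorem isClosed_ztV_iff (e : M ≃ₗ[ℂ] (B → ℂ)) (Z : Set M) :
    @IsClosed M (ztV M) Z ↔ ∃ J : Ideal (MvPolynomial B ℂ), Z = e ⁻¹' zeroLocus ℂ J := by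
  classical
  constructor
  · intro h
    suffices H : ∀ U : Set M, TopologicalSpace.GenerateOpen
        { U | ∃ (k : ℕ) (p : MvPolynomial (Fin k) ℂ) (L : Fin k → M →ₗ[ℂ] ℂ),
          U = { x | MvPolynomial.eval (fun i => L i x) p ≠ 0 } } U →
        ∃ J : Ideal (MvPolynomial B ℂ), Uᶜ = e ⁻¹' zeroLocus ℂ J by
      have := H Zᶜ (@IsClosed.isOpen_compl _ (ztV M) _ h)
      rwa [compl_compl] at this
    intro U hU
    induction hU with
    | basic U hU =>
      obtain ⟨k, p, L, rfl⟩ := hU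
      refine ⟨Ideal.span {aeval (fun i => ∑ b, C (L i (e.symm (Pi.single b 1))) * X b) p}, ?_⟩
      ext x
      rw [zeroLocus_span]
      have hx : ∀ i, L i x = ∑ b, L i (e.symm (Pi.single b 1)) * e x b := by
        intro i
        have : x = ∑ b, e x b • e.symm (Pi.single b 1) := by
          apply e.injective
          simp only [map_sum, map_smul, e.apply_symm_apply]
          exact pi_eq_sum_univ' _
        conv_lhs => rw [this]
        simp [mul_comm]
      simp only [Set.mem_compl_iff, Set.mem_ofPred_eq, not_not, Set.mem_preimage,
        Set.mem_singleton_iff, forall_eq, hx]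
      change _ ↔ eval (e x) _ = 0
      simp only [eval_aeval, map_sum, map_mul, eval_C, eval_X]
    | univ => exact ⟨⊤, by simp⟩
    | inter U V _ _ hU hV =>
      obtain ⟨J, hJ⟩ := hU
      obtain ⟨K, hK⟩ := hV
      refine ⟨J * K, ?_⟩
      rw [Set.compl_inter, hJ, hK]
      ext x
      constructor
      · have h1 : J * K ≤ J := Ideal.mul_le_left
        have h2 : J * K ≤ K := Ideal.mul_le_right
        rintro (h | h)
        · exact zeroLocus_anti_mono h1 h
        · exact zeroLocus_anti_mono h2 h
      · intro h
        by_contra! h'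
        simp only [Set.mem_union, Set.mem_preimage, mem_zeroLocus_iff, not_or, not_forall] at h'
        obtain ⟨⟨a, ha, ha'⟩, b, hb, hb'⟩ := h'
        have := h (a * b) (Ideal.mul_mem_mul ha hb)
        rw [map_mul] at this
        exact (mul_ne_zero ha' hb') this
    | sUnion S _ hS =>
      choose! J hJ using hS
      refine ⟨⨆ U ∈ S, J U, ?_⟩
      ext x
      have : ∀ K : Ideal (MvPolynomial B ℂ), e x ∈ zeroLocus ℂ K ↔
          K ≤ vanishingIdeal ℂ {e x} := fun K => by
        rw [← le_zeroLocus_iff_le_vanishingIdeal]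
        exact Set.singleton_subset_iff.symm
      rw [Set.mem_preimage, this, iSup₂_le_iff]
      simp only [← this, Set.compl_sUnion, Set.sInter_image, Set.mem_iInter]
      refine forall₂_congr fun U hU => ?_
      rw [hJ U hU]
      rfl
  · rintro ⟨J, rfl⟩
    have : e ⁻¹' zeroLocus ℂ J = ⋂ p ∈ J, {x | eval (e x) p = 0} := by
      ext x
      simp
    rw [this]
    let := ztV M
    refine isClosed_biInter fun p _ => ⟨TopologicalSpace.GenerateOpen.basic _
      ⟨Fintype.card B, rename (Fintype.equivFin B) p,
        fun i => LinearMap.proj ((Fintype.equivFin B).symm i) ∘ₗ e.toLinearMap, ?_⟩⟩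
    ext x
    simp [eval_rename, Function.comp_def]

theorem zClosureV_eq (e : M ≃ₗ[ℂ] (B → ℂ)) (Y : Set M) :
    zClosureV Y = e ⁻¹' zeroLocus ℂ (vanishingIdeal ℂ (e '' Y)) := by
  let := ztV M
  refine Set.Subset.antisymm (closure_minimal ?_ ((isClosed_ztV_iff e _).2 ⟨_, rfl⟩)) ?_
  · exact fun y hy => zeroLocus_vanishingIdeal_le _ ⟨y, hy, rfl⟩
  · obtain ⟨J, hJ⟩ := (isClosed_ztV_iff e (closure Y)).1 isClosed_closure
    change closure Y ⊇ _
    rw [hJ]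
    refine Set.preimage_mono (zeroLocus_anti_mono ?_)
    rw [← le_zeroLocus_iff_le_vanishingIdeal]
    rintro _ ⟨y, hy, rfl⟩
    have : y ∈ closure Y := subset_closure hy
    rwa [hJ] at this

theorem zDimV_eq (e : M ≃ₗ[ℂ] (B → ℂ)) (J : Ideal (MvPolynomial B ℂ)) :
    zDimV (e ⁻¹' zeroLocus ℂ J) = ringKrullDim (MvPolynomial B ℂ ⧸ J) := by
  let := ztV M
  refine topologicalKrullDim_eq_ringKrullDim (fun x => e x.1) (fun Z => ?_) J ?_
  · rw [isClosed_induced_iff]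
    constructor
    · rintro ⟨T, hT, rfl⟩
      obtain ⟨K, rfl⟩ := (isClosed_ztV_iff e T).1 hT
      exact ⟨K, rfl⟩
    · rintro ⟨K, rfl⟩
      exact ⟨_, (isClosed_ztV_iff e _).2 ⟨K, rfl⟩, rfl⟩
  · ext x
    constructor
    · rintro ⟨y, rfl⟩
      exact y.2
    · intro hx
      exact ⟨⟨e.symm x, by simpa using hx⟩, by simp⟩

variable {τ : Type} [Fintype τ]

/-- The Zariski closure of the image of a polynomial map has dimension the generic rank of its
Jacobian. -/
theorem zDimV_zClosureV_range (e : M ≃ₗ[ℂ] (B → ℂ)) (f : B → MvPolynomial τ ℂ) :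
    zDimV (zClosureV (Set.range fun θ : τ → ℂ => e.symm fun b => eval θ (f b))) =
      (genericRank f : WithBot ℕ∞) := by
  rw [zClosureV_eq e, zDimV_eq, ← Set.range_comp]
  have : (e ∘ fun θ : τ → ℂ => e.symm fun b => eval θ (f b)) = fun θ b => eval θ (f b) :=
    funext fun θ => e.apply_symm_apply _
  rw [this, vanishingIdeal_range_eval, ← ringKrullDim_aeval_range]
  let φ : MvPolynomial B ℂ →ₐ[ℂ] MvPolynomial τ ℂ := aeval f
  have hker : RingHom.ker φ.rangeRestrict = RingHom.ker φ := by
    ext p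
    simp only [RingHom.mem_ker, ← Subtype.val_inj]
    rfl
  change ringKrullDim (MvPolynomial B ℂ ⧸ RingHom.ker φ) = ringKrullDim φ.range
  rw [← hker]
  exact ringKrullDim_eq_of_ringEquiv
    (RingHom.quotientKerEquivOfSurjective (f := φ.rangeRestrict.toRingHom)
      φ.rangeRestrict_surjective)

theorem zClosureV_range_eq_univ (e : M ≃ₗ[ℂ] (B → ℂ)) (f : B → MvPolynomial τ ℂ)
    (h : genericRank f = Fintype.card B) :
    zClosureV (Set.range fun θ : τ → ℂ => e.symm fun b => eval θ (f b)) = Set.univ := by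
  obtain ⟨θ, hθ⟩ := exists_finrank_range_jacobianAt_eq f
  have hsurj : Function.Surjective (jacobianAt f θ) := by
    rw [← LinearMap.range_eq_top]
    exact Submodule.eq_top_of_finrank_eq (by rw [hθ, h]; simp)
  rw [zClosureV_eq e, ← Set.range_comp]
  have : (e ∘ fun θ : τ → ℂ => e.symm fun b => eval θ (f b)) = fun θ b => eval θ (f b) :=
    funext fun θ => e.apply_symm_apply _
  rw [this, vanishingIdeal_range_eval, (RingHom.injective_iff_ker_eq_bot _).1
    (algebraicIndependent_of_jacobianAt_surjective f θ hsurj), zeroLocus_bot]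
  rfl

end Zariski

/-! ### Secant varieties of closed images -/

section Secant

variable {M : Type*} [AddCommGroup M] [Module ℂ M]

theorem continuous_ztV_const_add (a : M) :
    @Continuous M M (ztV M) (ztV M) fun x => a + x := by
  let := ztV M
  refine continuous_generateFrom_iff.2 ?_
  rintro _ ⟨k, p, L, rfl⟩
  refine TopologicalSpace.GenerateOpen.basic _
    ⟨k, aeval (fun i => C (L i a) + X i) p, L, ?_⟩
  ext x
  simp only [Set.mem_preimage, Set.mem_ofPred_eq, eval_aeval, map_add, eval_C, eval_X]

theorem sum_mem_zClosureV (Y : Set M) (m : ℕ) (x : Fin m → M) (hx : ∀ i, x i ∈ zClosureV Y) :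
    ∑ i, x i ∈ zClosureV {p | ∃ y : Fin m → M, (∀ i, y i ∈ Y) ∧ p = ∑ i, y i} := by
  let := ztV M
  induction m with
  | zero => exact subset_closure ⟨x, fun i => i.elim0, rfl⟩
  | succ m ih =>
    rw [Fin.sum_univ_succ]
    have hs := ih (fun i => x i.succ) fun i => hx _
    have h₁ : ∀ y ∈ Y, y + ∑ i : Fin m, x i.succ ∈
        closure {p | ∃ y : Fin (m + 1) → M, (∀ i, y i ∈ Y) ∧ p = ∑ i, y i} := by
      intro y hy
      refine map_mem_closure (continuous_ztV_const_add y) hs ?_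
      rintro _ ⟨z, hz, rfl⟩
      exact ⟨Fin.cons y z, Fin.cases hy hz, by simp [Fin.sum_univ_succ]⟩
    have h₂ := map_mem_closure (continuous_ztV_const_add (∑ i : Fin m, x i.succ)) (hx 0)
      (t := closure {p | ∃ y : Fin (m + 1) → M, (∀ i, y i ∈ Y) ∧ p = ∑ i, y i})
      fun y hy => add_comm y _ ▸ h₁ y hy
    rw [closure_closure] at h₂
    rw [add_comm (x 0)]
    exact h₂

theorem secantV_zClosureV (m : ℕ) (Y : Set M) :
    secantV m (zClosureV Y) = zClosureV {p | ∃ y : Fin m → M, (∀ i, y i ∈ Y) ∧ p = ∑ i, y i} := by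
  let := ztV M
  refine Set.Subset.antisymm (closure_minimal ?_ isClosed_closure) (closure_mono ?_)
  · rintro _ ⟨x, hx, rfl⟩
    exact sum_mem_zClosureV Y m x hx
  · rintro _ ⟨x, hx, rfl⟩
    exact ⟨x, fun i => subset_closure (hx i), rfl⟩

end Secant

section SumMap

variable {B τ : Type}

/-- The sum of copies, indexed by `ι`, of a polynomial map in separate variables. -/
def sumMap (ι : Type*) [Fintype ι] (f : B → MvPolynomial τ ℂ) (b : B) : MvPolynomial (ι × τ) ℂ :=
  ∑ i, rename (Prod.mk i) (f b)

theorem eval_sumMap {ι : Type*} [Fintype ι] (f : B → MvPolynomial τ ℂ) (x : ι × τ → ℂ) (b : B) :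
    eval x (sumMap ι f b) = ∑ i, eval (fun t => x (i, t)) (f b) := by
  simp [sumMap, eval_rename, Function.comp_def]

theorem secantV_zClosureV_range {M : Type*} [AddCommGroup M] [Module ℂ M] (e : M ≃ₗ[ℂ] (B → ℂ))
    (f : B → MvPolynomial τ ℂ) (m : ℕ) :
    secantV m (zClosureV (Set.range fun θ : τ → ℂ => e.symm fun b => eval θ (f b))) =
      zClosureV (Set.range fun x : Fin m × τ → ℂ =>
        e.symm fun b => eval x (sumMap (Fin m) f b)) := by
  rw [secantV_zClosureV]
  congr 1
  have key : ∀ x : Fin m → τ → ℂ, (e.symm fun b => ∑ i, eval (x i) (f b)) =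
      ∑ i, e.symm fun b => eval (x i) (f b) := fun x => by
    rw [← map_sum]
    congr 1
    ext b
    simp
  ext p
  simp only [Set.mem_ofPred_eq, Set.mem_range, eval_sumMap]
  constructor
  · rintro ⟨y, hy, rfl⟩
    choose x hx using hy
    exact ⟨fun j => x j.1 j.2, by simp only [key fun i => x i, hx]⟩
  · rintro ⟨x, rfl⟩
    exact ⟨_, fun i => ⟨fun t => x (i, t), rfl⟩, key fun i t => x (i, t)⟩

variable [Fintype B] [Fintype τ]

theorem jacobianAt_sumMap {ι : Type} [Fintype ι] (f : B → MvPolynomial τ ℂ) (x u : ι × τ → ℂ) :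
    jacobianAt (sumMap ι f) x u =
      ∑ i, jacobianAt f (fun t => x (i, t)) (fun t => u (i, t)) := by
  have h₁ := hasFDerivAt_eval_pi (sumMap ι f) x
  have h₂ : HasFDerivAt (fun (x : ι × τ → ℂ) => ∑ i, fun b => eval (fun t => x (i, t)) (f b))
      (∑ i, (LinearMap.toContinuousLinearMap (jacobianAt f fun t => x (i, t))).comp
        (ContinuousLinearMap.pi fun t => ContinuousLinearMap.proj (i, t))) x := by
    refine HasFDerivAt.fun_sum fun i _ => ?_
    exact (hasFDerivAt_eval_pi f fun t => x (i, t)).comp x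
      (ContinuousLinearMap.pi fun t => ContinuousLinearMap.proj (i, t) :
        (ι × τ → ℂ) →L[ℂ] τ → ℂ).hasFDerivAt
  have h₃ : (fun (x : ι × τ → ℂ) b => eval x (sumMap ι f b)) =
      fun x => ∑ i, fun b => eval (fun t => x (i, t)) (f b) := by
    ext x b
    simp [eval_sumMap]
  rw [h₃] at h₁
  have := congrArg (fun L => L u) (h₁.unique h₂)
  simpa [Function.comp_def] using this

theorem range_jacobianAt_sumMap {ι : Type} [Fintype ι] (f : B → MvPolynomial τ ℂ)
    (x : ι × τ → ℂ) :
    LinearMap.range (jacobianAt (sumMap ι f) x) =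
      ⨆ i, LinearMap.range (jacobianAt f fun t => x (i, t)) := by
  classical
  apply le_antisymm
  · rintro _ ⟨u, rfl⟩
    rw [jacobianAt_sumMap]
    exact Submodule.sum_mem _ fun i _ => Submodule.mem_iSup_of_mem i ⟨_, rfl⟩
  · refine iSup_le fun i => ?_
    rintro _ ⟨u, rfl⟩
    refine ⟨fun j => if j.1 = i then u j.2 else 0, ?_⟩
    rw [jacobianAt_sumMap, Finset.sum_eq_single i]
    · simp
    · intro j _ hj
      simp only [hj, if_false]
      exact map_zero _
    · simp

end SumMap

/-! ### Growth of the ranks of secant varieties -/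

/-- A bounded sequence starting at zero that is monotone and concave, and strictly concave beyond
its linear range as long as it is below the bound, grows linearly and then
reaches the bound within `R 1` steps. -/
theorem eq_mul_and_eq_of_strictly_concave {R : ℕ → ℕ} {D : ℕ} (h0 : R 0 = 0) (hmono : Monotone R)
    (hadd : ∀ k, R (k + 1) ≤ R k + R 1) (hconc : ∀ k, R (k + 2) + R k ≤ 2 * R (k + 1))
    (hD : ∀ k, R k ≤ D)
    (hkey : ∀ k, R (k + 2) + R k = 2 * R (k + 1) → R (k + 1) < R k + R 1 → R k = D) (m : ℕ) :
    (R 1 * (m + R 1) ≤ D → R m = m * R 1) ∧ (D + R 1 ^ 2 ≤ m * R 1 → R m = D) := by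
  obtain hN | hN := Nat.eq_zero_or_pos (R 1)
  · have hR : ∀ m, R m = 0 := fun m => by
      induction m with
      | zero => exact h0
      | succ k ih => have := hadd k; omega
    rw [hN, hR m]
    constructor
    · simp
    · intro h
      simp at h
      omega
  have hex : ∃ k, R (k + 1) < R k + R 1 := by
    by_contra! h
    have : ∀ k, k ≤ R k := fun k => by
      induction k with
      | zero => omega
      | succ k ih => have := h k; omega
    have h₁ := this (D + 1)
    have h₂ := hD (D + 1)
    omega
  obtain ⟨K, hK, hmin⟩ : ∃ K, R (K + 1) < R K + R 1 ∧ ∀ k < K, ¬ R (k + 1) < R k + R 1 :=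
    ⟨Nat.find hex, Nat.find_spec hex, fun k hk => Nat.find_min hex hk⟩
  have hlin : ∀ k ≤ K, R k = k * R 1 := by
    intro k hk
    induction k with
    | zero => simpa using h0
    | succ k ih =>
      have h₁ := ih (by omega)
      have h₂ := hmin k (by omega)
      have h₃ := hadd k
      rw [add_mul, one_mul]
      omega
  have hlt : ∀ j, R (K + j + 1) < R (K + j) + R 1 := by
    intro j
    induction j with
    | zero => simpa using hK
    | succ j ih =>
      have := hconc (K + j)
      change R (K + j + 1 + 1) < R (K + j + 1) + R 1
      change R (K + j + 1 + 1) + _ ≤ _ at this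
      omega
  have hub : ∀ j, R (K + j) + j ≤ K * R 1 + j * R 1 := by
    intro j
    induction j with
    | zero => simpa using (hlin K le_rfl).le
    | succ j ih =>
      have := hlt j
      rw [add_mul, one_mul]
      change R (K + j + 1) + _ ≤ _
      omega
  have hstep : ∀ j, R (K + j) = D ∨ R (K + j + 1) + j + 1 ≤ R (K + j) + R 1 := by
    intro j
    induction j with
    | zero => exact Or.inr hK
    | succ j ih =>
      change R (K + j + 1) = D ∨ R (K + j + 1 + 1) + (j + 1) + 1 ≤ R (K + j + 1) + R 1
      have h₁ := hconc (K + j)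
      have h₂ := hkey (K + j)
      have h₃ := hlt j
      have h₄ := hD (K + j + 1)
      have h₅ : R (K + j) ≤ R (K + j + 1) := hmono (Nat.le_succ _)
      change R (K + j + 1 + 1) + _ ≤ _ at h₁
      change R (K + j + 1 + 1) + _ = _ → _ at h₂
      by_cases h : R (K + j) = D
      · omega
      · have : ¬ (R (K + j + 1 + 1) + R (K + j) = 2 * R (K + j + 1)) := fun h' => h (h₂ h' h₃)
        omega
  have htop : R (K + R 1) = D := by
    have h₁ := hstep (R 1)
    have h₂ : R (K + R 1) ≤ R (K + R 1 + 1) := hmono (Nat.le_succ _)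
    omega
  constructor
  · intro h
    refine hlin m ?_
    have h₁ := hub (R 1)
    rw [htop] at h₁
    by_contra! h₂
    nlinarith
  · intro h
    refine le_antisymm (hD m) ?_
    rw [← htop]
    refine hmono ?_
    have h₁ := hD K
    rw [hlin K le_rfl] at h₁
    have h₂ : (K + R 1) * R 1 ≤ m * R 1 := by nlinarith
    exact Nat.le_of_mul_le_mul_right h₂ hN

section SecantRank

variable {B τ : Type} [Fintype τ]

/-- The span of the tangent spaces at the points of `x` indexed by `s`. -/
def tangentSpan (f : B → MvPolynomial τ ℂ) (s : Finset ℕ) (x : ℕ × τ → ℂ) :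
    Submodule ℂ (B → ℂ) :=
  ⨆ i ∈ s, LinearMap.range (jacobianAt f fun t => x (i, t))

theorem tangentSpan_mono (f : B → MvPolynomial τ ℂ) {s s' : Finset ℕ} (h : s ⊆ s')
    (x : ℕ × τ → ℂ) : tangentSpan f s x ≤ tangentSpan f s' x :=
  biSup_mono fun _ hi => h hi

theorem tangentSpan_congr (f : B → MvPolynomial τ ℂ) {s : Finset ℕ} {x y : ℕ × τ → ℂ}
    (h : ∀ i ∈ s, ∀ t, x (i, t) = y (i, t)) : tangentSpan f s x = tangentSpan f s y := by
  refine iSup_congr fun i => iSup_congr fun hi => ?_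
  rw [funext (h i hi)]

/-- The generic rank of the Jacobian of the map adding `k` points. -/
def secantRank (f : B → MvPolynomial τ ℂ) (k : ℕ) : ℕ := genericRank (sumMap (Fin k) f)

theorem tangentSpan_insert (f : B → MvPolynomial τ ℂ) (a : ℕ) (s : Finset ℕ) (x : ℕ × τ → ℂ) :
    tangentSpan f (insert a s) x = tangentSpan f {a} x ⊔ tangentSpan f s x := by
  classical
  rw [tangentSpan, Finset.iSup_insert, tangentSpan, Finset.iSup_singleton]
  rfl

variable [Fintype B]

theorem eventually_finrank_tangentSpan (f : B → MvPolynomial τ ℂ) (s : Finset ℕ) {k : ℕ}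
    (hk : s.card = k) :
    ∀ᶠ x in genericFilter (ℕ × τ), Module.finrank ℂ (tangentSpan f s x) = secantRank f k := by
  classical
  let σ : Fin k ≃ s := (finCongr hk.symm).trans s.equivFin.symm
  have hσ : Function.Injective fun j : Fin k × τ => ((σ j.1 : ℕ), j.2) := by
    rintro ⟨i, t⟩ ⟨i', t'⟩ h
    simp only [Prod.mk.injEq, Subtype.coe_inj, EmbeddingLike.apply_eq_iff_eq] at h
    exact Prod.ext h.1 h.2
  have ht := tendsto_genericFilter (fun j : Fin k × τ => (X ((σ j.1 : ℕ), j.2)))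
    (fun y => ⟨Function.extend (fun j : Fin k × τ => ((σ j.1 : ℕ), j.2)) y 0, by
      ext j
      simpa only [eval_X] using hσ.extend_apply y 0 j⟩)
  simp only [eval_X] at ht
  filter_upwards [ht.eventually (eventually_finrank_range_jacobianAt (sumMap (Fin k) f))] with x hx
  rw [secantRank, ← hx, range_jacobianAt_sumMap,
    σ.iSup_comp (g := fun i : s => LinearMap.range (jacobianAt f fun t => x ((i : ℕ), t))),
    tangentSpan, iSup_subtype]

theorem eventually_finrank_inf_tangentSpan (f : B → MvPolynomial τ ℂ) (a : ℕ) (s : Finset ℕ)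
    {k : ℕ} (hk : s.card = k) (ha : a ∉ s) :
    ∀ᶠ x in genericFilter (ℕ × τ),
      Module.finrank ℂ (tangentSpan f {a} x ⊓ tangentSpan f s x : Submodule ℂ (B → ℂ)) +
        secantRank f (k + 1) = secantRank f 1 + secantRank f k := by
  filter_upwards [eventually_finrank_tangentSpan f {a} (Finset.card_singleton a),
    eventually_finrank_tangentSpan f s hk,
    eventually_finrank_tangentSpan f (insert a s) (by rw [Finset.card_insert_of_notMem ha, hk])]
    with x h₁ h₂ h₃
  rw [← h₁, ← h₂, ← h₃, tangentSpan_insert, add_comm]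
  exact Submodule.finrank_sup_add_finrank_inf_eq _ _

theorem secantRank_zero (f : B → MvPolynomial τ ℂ) : secantRank f 0 = 0 := by
  obtain ⟨x, hx⟩ := (eventually_finrank_tangentSpan f ∅ Finset.card_empty).exists
  rw [← hx, tangentSpan]
  simp

theorem secantRank_le_card (f : B → MvPolynomial τ ℂ) (k : ℕ) :
    secantRank f k ≤ Fintype.card B := by
  obtain ⟨x, hx⟩ := (eventually_finrank_tangentSpan f _ (Finset.card_range k)).exists
  rw [← hx, ← Module.finrank_fintype_fun_eq_card ℂ]
  exact Submodule.finrank_le _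

theorem secantRank_mono (f : B → MvPolynomial τ ℂ) : Monotone (secantRank f) := by
  intro k l hkl
  obtain ⟨x, hx, hx'⟩ := ((eventually_finrank_tangentSpan f _ (Finset.card_range k)).and
    (eventually_finrank_tangentSpan f _ (Finset.card_range l))).exists
  rw [← hx, ← hx']
  exact Submodule.finrank_mono (tangentSpan_mono f (Finset.range_mono hkl) x)

theorem secantRank_succ_le (f : B → MvPolynomial τ ℂ) (k : ℕ) :
    secantRank f (k + 1) ≤ secantRank f k + secantRank f 1 := by
  obtain ⟨x, hx⟩ := (eventually_finrank_inf_tangentSpan f k _ (Finset.card_range k)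
    Finset.notMem_range_self).exists
  omega

theorem card_Ioc_add (j k : ℕ) : (Finset.Ioc j (j + k)).card = k := by simp

theorem zero_notMem_Ioc (j k : ℕ) : 0 ∉ Finset.Ioc j k := by simp

theorem secantRank_concave (f : B → MvPolynomial τ ℂ) (k : ℕ) :
    secantRank f (k + 2) + secantRank f k ≤ 2 * secantRank f (k + 1) := by
  obtain ⟨x, hx, hx'⟩ := ((eventually_finrank_inf_tangentSpan f 0 _ (card_Ioc_add 0 k)
    (zero_notMem_Ioc _ _)).and (eventually_finrank_inf_tangentSpan f 0 _ (card_Ioc_add 0 (k + 1))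
    (zero_notMem_Ioc _ _))).exists
  have := Submodule.finrank_mono (inf_le_inf_left (tangentSpan f {0} x)
    (tangentSpan_mono f (Finset.Ioc_subset_Ioc_right (show 0 + k ≤ 0 + (k + 1) by omega)
      (a := 0)) x))
  change _ + secantRank f (k + 2) = _ at hx'
  omega

theorem eventually_inf_tangentSpan_eq (f : B → MvPolynomial τ ℂ) {k : ℕ}
    (h : secantRank f (k + 2) + secantRank f k = 2 * secantRank f (k + 1)) {s s' : Finset ℕ}
    (hs : s.card = k) (hs' : s'.card = k + 1) (hss' : s ⊆ s') (h0 : 0 ∉ s') :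
    ∀ᶠ x in genericFilter (ℕ × τ),
      tangentSpan f {0} x ⊓ tangentSpan f s x = tangentSpan f {0} x ⊓ tangentSpan f s' x := by
  filter_upwards [eventually_finrank_inf_tangentSpan f 0 s hs fun h => h0 (hss' h),
    eventually_finrank_inf_tangentSpan f 0 s' hs' h0] with x hx hx'
  refine Submodule.eq_of_le_of_finrank_eq
    (inf_le_inf_left _ (tangentSpan_mono f hss' x)) ?_
  change _ + secantRank f (k + 2) = _ at hx'
  omega

theorem eventually_inf_tangentSpan_Ioc_eq (f : B → MvPolynomial τ ℂ) {k : ℕ}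
    (h : secantRank f (k + 2) + secantRank f k = 2 * secantRank f (k + 1)) (j : ℕ) :
    ∀ᶠ x in genericFilter (ℕ × τ),
      tangentSpan f {0} x ⊓ tangentSpan f (Finset.Ioc 0 (0 + k)) x =
        tangentSpan f {0} x ⊓ tangentSpan f (Finset.Ioc j (j + k)) x := by
  induction j with
  | zero => exact Filter.Eventually.of_forall fun _ => rfl
  | succ j ih =>
    filter_upwards [ih,
      eventually_inf_tangentSpan_eq f h (card_Ioc_add j k) (card_Ioc_add j (k + 1))
        (Finset.Ioc_subset_Ioc_right (by omega)) (zero_notMem_Ioc _ _),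
      eventually_inf_tangentSpan_eq f h (card_Ioc_add (j + 1) k) (card_Ioc_add j (k + 1))
        (Finset.Ioc_subset_Ioc (by omega) (by omega)) (zero_notMem_Ioc _ _)] with x h₁ h₂ h₃
    rw [h₁, h₂, h₃]

/-- A linear map `S` permuting the tangent spaces of `f` along a polynomial substitution. -/
def IsTangentSymmetry (f : B → MvPolynomial τ ℂ) (S : (B → ℂ) →ₗ[ℂ] (B → ℂ)) : Prop :=
  ∃ A : τ → MvPolynomial τ ℂ, Function.Surjective (fun (θ : τ → ℂ) t => eval θ (A t)) ∧
    ∀ θ, (LinearMap.range (jacobianAt f fun t => eval θ (A t))).map S ≤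
      LinearMap.range (jacobianAt f θ)

/-- If the tangent symmetries of `f` act irreducibly and the secant ranks fail to be strictly
concave beyond their linear range, then the secant variety fills the ambient space. -/
theorem secantRank_eq_card (f : B → MvPolynomial τ ℂ)
    (hsym : ∀ v ≠ 0, Submodule.span ℂ {w | ∃ S, IsTangentSymmetry f S ∧ S v = w} = ⊤) (k : ℕ)
    (h : secantRank f (k + 2) + secantRank f k = 2 * secantRank f (k + 1))
    (hlt : secantRank f (k + 1) < secantRank f k + secantRank f 1) :
    secantRank f k = Fintype.card B := by
  classical
  obtain ⟨x₀, hx₀⟩ := exists_eventually_genericFilter_ite (fun j : ℕ × τ => j.1 ≤ k)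
    ((eventually_finrank_inf_tangentSpan f 0 _ (card_Ioc_add 0 k) (zero_notMem_Ioc _ _)).and
      (eventually_inf_tangentSpan_Ioc_eq f h k))
  have e₁ : ∀ x : ℕ × τ → ℂ, tangentSpan f {0} (fun j => if j.1 ≤ k then x₀ j else x j) =
      tangentSpan f {0} x₀ := fun x => tangentSpan_congr f fun i hi t => by
    rw [Finset.mem_singleton.1 hi]
    exact if_pos (Nat.zero_le k)
  have e₂ : ∀ x : ℕ × τ → ℂ, tangentSpan f (Finset.Ioc 0 (0 + k))
      (fun j => if j.1 ≤ k then x₀ j else x j) = tangentSpan f (Finset.Ioc 0 (0 + k)) x₀ :=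
    fun x => tangentSpan_congr f fun i hi t => if_pos (by simp at hi; omega)
  have e₃ : ∀ x : ℕ × τ → ℂ, tangentSpan f (Finset.Ioc k (k + k))
      (fun j => if j.1 ≤ k then x₀ j else x j) = tangentSpan f (Finset.Ioc k (k + k)) x :=
    fun x => tangentSpan_congr f fun i hi t => if_neg (by simp at hi; omega)
  simp only [e₁, e₂, e₃] at hx₀
  obtain ⟨x, hx, -⟩ := hx₀.exists
  rw [e₁, e₂] at hx
  obtain ⟨v, hv, hv0⟩ := Submodule.exists_mem_ne_zero_of_ne_bot (p := tangentSpan f {0} x₀ ⊓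
    tangentSpan f (Finset.Ioc 0 (0 + k)) x₀) (by
      intro h
      rw [h, finrank_bot] at hx
      omega)
  let G : Submodule ℂ (B → ℂ) :=
    { carrier := {w | ∀ᶠ x in genericFilter (ℕ × τ), w ∈ tangentSpan f (Finset.Ioc k (k + k)) x}
      zero_mem' := by
        rw [Set.mem_ofPred_eq]
        exact Filter.Eventually.of_forall fun x => Submodule.zero_mem _
      add_mem' := fun ha hb => by
        rw [Set.mem_ofPred_eq] at ha hb ⊢
        filter_upwards [ha, hb] with x h₁ h₂ using Submodule.add_mem _ h₁ h₂
      smul_mem' := fun c w hw => by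
        rw [Set.mem_ofPred_eq] at hw ⊢
        filter_upwards [hw] with x h₁ using Submodule.smul_mem _ _ h₁ }
  have hvG : v ∈ G := by
    filter_upwards [hx₀] with x hx
    rw [hx.2] at hv
    exact hv.2
  have hG : G = ⊤ := by
    rw [eq_top_iff, ← hsym v hv0, Submodule.span_le]
    rintro _ ⟨S, ⟨A, hA, hS⟩, rfl⟩
    have ht := tendsto_genericFilter
      (fun j : ℕ × τ => rename (fun t => (j.1, t)) (A j.2)) (fun y => by
        choose θ hθ using fun i => hA fun t => y (i, t)
        refine ⟨fun j => θ j.1 j.2, funext fun j => ?_⟩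
        simpa only [eval_rename, Function.comp_def] using congrFun (hθ j.1) j.2)
    filter_upwards [ht.eventually hvG] with x hx
    refine (?_ : (tangentSpan f _ _).map S ≤ _) (Submodule.mem_map_of_mem hx)
    rw [tangentSpan, Submodule.map_iSup]
    refine iSup_le fun i => ?_
    rw [Submodule.map_iSup]
    refine iSup_le fun hi => ?_
    refine le_trans ?_ (le_iSup₂_of_le i hi le_rfl)
    refine le_trans (le_of_eq ?_) (hS fun t => x (i, t))
    simp only [eval_rename, Function.comp_def]
  have htop : ∀ᶠ x in genericFilter (ℕ × τ), ∀ b : B,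
      Pi.single b 1 ∈ tangentSpan f (Finset.Ioc k (k + k)) x :=
    Filter.eventually_all.2 fun b =>
      (hG ▸ Submodule.mem_top : (Pi.single b 1 : B → ℂ) ∈ G)
  obtain ⟨x, hx, hx'⟩ :=
    (htop.and (eventually_finrank_tangentSpan f _ (card_Ioc_add k k))).exists
  have hspan : tangentSpan f (Finset.Ioc k (k + k)) x = ⊤ := ?_
  · rw [← hx', ← Module.finrank_fintype_fun_eq_card ℂ, hspan, finrank_top]
  rw [eq_top_iff, ← (Pi.basisFun ℂ B).span_eq, Submodule.span_le]
  rintro _ ⟨b, rfl⟩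
  simpa using hx b

theorem secantRank_one (f : B → MvPolynomial τ ℂ) : secantRank f 1 = genericRank f := by
  have ht := tendsto_genericFilter (fun t : τ => (X ((0 : ℕ), t) : MvPolynomial (ℕ × τ) ℂ))
    (fun y => ⟨fun j => y j.2, by simp⟩)
  simp only [eval_X] at ht
  obtain ⟨x, h₁, h₂⟩ := ((ht.eventually (eventually_finrank_range_jacobianAt f)).and
    (eventually_finrank_tangentSpan f {0} (Finset.card_singleton 0))).exists
  rw [← h₁, ← h₂, tangentSpan, Finset.iSup_singleton]

theorem secantRank_eq_mul_and_eq_card (f : B → MvPolynomial τ ℂ)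
    (hsym : ∀ v ≠ 0, Submodule.span ℂ {w | ∃ S, IsTangentSymmetry f S ∧ S v = w} = ⊤) (m : ℕ) :
    (genericRank f * (m + genericRank f) ≤ Fintype.card B →
      secantRank f m = m * genericRank f) ∧
    (Fintype.card B + genericRank f ^ 2 ≤ m * genericRank f →
      secantRank f m = Fintype.card B) := by
  rw [← secantRank_one]
  exact eq_mul_and_eq_of_strictly_concave (secantRank_zero f) (secantRank_mono f)
    (secantRank_succ_le f) (secantRank_concave f) (secantRank_le_card f)
    (secantRank_eq_card f hsym) m

end SecantRank

/-! ### The parametrization of the low-rank Gaussian moment variety -/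

/-- The exponents of the monomials of degree `d` in `n` variables. -/
abbrev Exponent (n d : ℕ) : Type := ↥(Finset.finsuppAntidiag (Finset.univ : Finset (Fin n)) d)

theorem card_exponent (n d : ℕ) : Fintype.card (Exponent n d) = (n + d - 1).choose d := by
  rw [Fintype.card_coe, Finset.card_finsuppAntidiag_nat_eq_choose, Finset.card_fin]

theorem mem_finsuppAntidiag_univ_iff {n d : ℕ} {b : Fin n →₀ ℕ} :
    b ∈ Finset.finsuppAntidiag (Finset.univ : Finset (Fin n)) d ↔ b.degree = d := by
  simp [Finset.mem_finsuppAntidiag, Finsupp.degree_eq_sum]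

/-- The form of degree `d` with a given family of coefficients. -/
def ofCoeffs (n d : ℕ) : (Exponent n d → ℂ) →ₗ[ℂ] MvPolynomial (Fin n) ℂ :=
  Fintype.linearCombination ℂ fun b : Exponent n d => monomial b.1 (1 : ℂ)

theorem ofCoeffs_eq_sum {n d : ℕ} (v : Exponent n d → ℂ) :
    ofCoeffs n d v = ∑ b, monomial b.1 (v b) := by
  simp [ofCoeffs, Fintype.linearCombination_apply, smul_monomial]

theorem isHomogeneous_ofCoeffs {n d : ℕ} (v : Exponent n d → ℂ) :
    (ofCoeffs n d v).IsHomogeneous d := by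
  rw [ofCoeffs_eq_sum]
  exact IsHomogeneous.sum _ _ _ fun b _ =>
    isHomogeneous_monomial _ (mem_finsuppAntidiag_univ_iff.1 b.2)

theorem coeff_ofCoeffs {n d : ℕ} (v : Exponent n d → ℂ) (b : Exponent n d) :
    coeff b.1 (ofCoeffs n d v) = v b := by
  classical
  simp [ofCoeffs_eq_sum, coeff_sum, coeff_monomial]

theorem ofCoeffs_coeff {n d : ℕ} {p : MvPolynomial (Fin n) ℂ} (hp : p.IsHomogeneous d) :
    ofCoeffs n d (fun b => coeff b.1 p) = p := by
  ext b
  by_cases hb : b.degree = d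
  · exact coeff_ofCoeffs _ ⟨b, mem_finsuppAntidiag_univ_iff.2 hb⟩
  · rw [(isHomogeneous_ofCoeffs _).coeff_eq_zero hb, hp.coeff_eq_zero hb]

/-- The coordinates on the space of forms given by the monomial basis. -/
def coeffEquiv (n d : ℕ) : ↥(homogeneousSubmodule (Fin n) ℂ d) ≃ₗ[ℂ] (Exponent n d → ℂ) where
  toFun p b := coeff b.1 p.1
  map_add' p q := by ext; simp
  map_smul' c p := by ext; simp
  invFun v := ⟨ofCoeffs n d v, isHomogeneous_ofCoeffs v⟩
  left_inv p := Subtype.ext (ofCoeffs_coeff p.2)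
  right_inv v := funext (coeff_ofCoeffs v)

section Param

variable {R : Type*} [CommRing R] {n : ℕ}

/-- The linear form with a given family of coefficients. -/
def linearForm (a : Fin n → R) : MvPolynomial (Fin n) R := ∑ i, C (a i) * X i

variable [Algebra ℂ R]

/-- The form `s_d(ℓ, q)` over an arbitrary `ℂ`-algebra, where `ℓ` has coefficients `θ (none, ·)`
and `q` is the sum of the squares of the linear forms with coefficients `θ (some k, ·)`. -/
def momentForm (d r : ℕ) (θ : Option (Fin r) × Fin n → R) : MvPolynomial (Fin n) R :=
  ∑ j ∈ Finset.range (d / 2 + 1),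
    ((1 : ℂ) / ((2 ^ j * Nat.factorial j * Nat.factorial (d - 2 * j) : ℕ) : ℂ)) •
      (linearForm (fun i => θ (none, i)) ^ (d - 2 * j) *
        (∑ k : Fin r, linearForm (fun i => θ (some k, i)) ^ 2) ^ j)

theorem map_linearForm {R' : Type*} [CommRing R'] [Algebra ℂ R'] (φ : R →ₐ[ℂ] R')
    (a : Fin n → R) : mapAlgHom φ (linearForm a) = linearForm fun i => φ (a i) := by
  simp [linearForm]

theorem map_momentForm {R' : Type*} [CommRing R'] [Algebra ℂ R'] (φ : R →ₐ[ℂ] R') (d r : ℕ)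
    (θ : Option (Fin r) × Fin n → R) :
    mapAlgHom φ (momentForm d r θ) = momentForm d r fun t => φ (θ t) := by
  simp only [momentForm, map_sum, map_smul, map_mul, map_pow, map_linearForm]

end Param

theorem isHomogeneous_linearForm {n : ℕ} (a : Fin n → ℂ) : (linearForm a).IsHomogeneous 1 :=
  IsHomogeneous.sum _ _ _ fun i _ => by
    simpa using (isHomogeneous_C (Fin n) (a i)).mul (isHomogeneous_X ℂ i)

theorem isHomogeneous_sum_sq_linearForm {n r : ℕ} (a : Fin r → Fin n → ℂ) :
    (∑ k, linearForm (a k) ^ 2).IsHomogeneous 2 :=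
  IsHomogeneous.sum _ _ _ fun k _ => by simpa using (isHomogeneous_linearForm (a k)).pow 2

theorem momentForm_eq_sMoment {n d r : ℕ} (θ : Option (Fin r) × Fin n → ℂ) :
    momentForm d r θ = sMoment n d (linearForm fun i => θ (none, i))
      (∑ k : Fin r, linearForm (fun i => θ (some k, i)) ^ 2) := rfl

theorem isHomogeneous_momentForm {n d r : ℕ} (θ : Option (Fin r) × Fin n → ℂ) :
    (momentForm d r θ).IsHomogeneous d := by
  refine IsHomogeneous.sum _ _ _ fun j hj => ?_
  rw [smul_eq_C_mul]
  have h := (isHomogeneous_C (Fin n) ((1 : ℂ) /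
    ((2 ^ j * Nat.factorial j * Nat.factorial (d - 2 * j) : ℕ) : ℂ))).mul
    (((isHomogeneous_linearForm fun i => θ (none, i)).pow (d - 2 * j)).mul
      ((isHomogeneous_sum_sq_linearForm fun (k : Fin r) i => θ (some k, i)).pow j))
  convert h using 1
  · rfl
  have := Finset.mem_range.1 hj
  omega

/-- The coordinates of the parametrization of the Gaussian moment variety. -/
def momentMap (n d r : ℕ) (b : Exponent n d) : MvPolynomial (Option (Fin r) × Fin n) ℂ :=
  coeff b.1 (momentForm d r X)

theorem eval_momentMap {n d r : ℕ} (θ : Option (Fin r) × Fin n → ℂ) (b : Exponent n d) :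
    eval θ (momentMap n d r b) = coeff b.1 (momentForm d r θ) := by
  have h := map_momentForm (aeval θ) d r (X : Option (Fin r) × Fin n → MvPolynomial _ ℂ)
  simp only [aeval_X] at h
  rw [← h, mapAlgHom_apply, momentMap]
  simp [coe_aeval_eq_eval, coeff_map]

theorem coeffEquiv_symm_eval_momentMap {n d r : ℕ} (θ : Option (Fin r) × Fin n → ℂ) :
    ((coeffEquiv n d).symm fun b => eval θ (momentMap n d r b) : MvPolynomial (Fin n) ℂ) =
      momentForm d r θ := by
  simp only [eval_momentMap]
  exact ofCoeffs_coeff (isHomogeneous_momentForm θ)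

/-! ### Quadratic forms of bounded rank -/

theorem linearForm_surjective {n : ℕ} {ℓ : MvPolynomial (Fin n) ℂ} (hℓ : ℓ.IsHomogeneous 1) :
    ∃ a, linearForm a = ℓ := by
  classical
  refine ⟨fun i => coeff (Finsupp.single i 1) ℓ, ?_⟩
  ext b
  by_cases hb : b.degree = 1
  · obtain ⟨i, rfl⟩ := (Finsupp.sum_eq_one_iff b).1 hb
    simp [linearForm, coeff_sum, coeff_C_mul, coeff_X, Finsupp.single_left_inj]
  · rw [(isHomogeneous_linearForm _).coeff_eq_zero hb, hℓ.coeff_eq_zero hb]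

theorem hessian_apply {n : ℕ} (q : MvPolynomial (Fin n) ℂ) (i j : Fin n) :
    hessian n q i j = coeff (Finsupp.single i 1 + Finsupp.single j 1) q *
      (((Finsupp.single i 1 : Fin n →₀ ℕ) j : ℂ) + 1) := by
  rw [hessian, Matrix.of_apply, eval_zero, constantCoeff_eq, coeff_pderiv, coeff_pderiv]
  simp

theorem hessian_symm {n : ℕ} (q : MvPolynomial (Fin n) ℂ) : (hessian n q).IsSymm := by
  ext i j
  rw [Matrix.transpose_apply, hessian_apply, hessian_apply, add_comm (Finsupp.single i 1)]
  simp [Finsupp.single_apply, eq_comm]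

theorem hessian_injective {n : ℕ} {q q' : MvPolynomial (Fin n) ℂ} (hq : q.IsHomogeneous 2)
    (hq' : q'.IsHomogeneous 2) (h : hessian n q = hessian n q') : q = q' := by
  ext b
  by_cases hb : b.degree = 2
  · obtain ⟨i, hi⟩ : ∃ i, b i ≠ 0 := by
      by_contra! h0
      have : b = 0 := Finsupp.ext h0
      simp [this] at hb
    obtain ⟨c, rfl⟩ : ∃ c, b = Finsupp.single i 1 + c :=
      le_iff_exists_add.1 (by simpa [Finsupp.single_le_iff] using Nat.one_le_iff_ne_zero.2 hi)
    obtain ⟨j, rfl⟩ := (Finsupp.sum_eq_one_iff c).1 (show c.degree = 1 by simp at hb; omega)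
    have := congr_fun₂ h i j
    rw [hessian_apply, hessian_apply] at this
    exact mul_right_cancel₀ (Nat.cast_add_one_ne_zero _) this
  · rw [hq.coeff_eq_zero hb, hq'.coeff_eq_zero hb]

theorem pderiv_linearForm {n : ℕ} (a : Fin n → ℂ) (i : Fin n) :
    pderiv i (linearForm a) = C (a i) := by
  classical
  simp [linearForm, Derivation.leibniz, pderiv_X, Pi.single_apply]

theorem hessian_sum_sq_linearForm {n r : ℕ} (A : Matrix (Fin r) (Fin n) ℂ) :
    hessian n (∑ k, linearForm (A k) ^ 2) = (2 : ℂ) • (A.transpose * A) := by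
  ext i j
  simp only [hessian, Matrix.of_apply, pow_two, map_sum, Derivation.leibniz, pderiv_linearForm,
    map_add, smul_eq_mul, pderiv_C, mul_zero, zero_add, map_mul, eval_C, Matrix.smul_apply,
    Matrix.mul_apply, Matrix.transpose_apply, Finset.mul_sum]
  exact Finset.sum_congr rfl fun k _ => by ring

/-- A complex symmetric matrix of rank at most `r` is of the form `AᵀA` with `A` having `r`
rows. -/
theorem exists_transpose_mul_self_eq {n r : ℕ} {H : Matrix (Fin n) (Fin n) ℂ} (hH : H.IsSymm)
    (hr : H.rank ≤ r) : ∃ A : Matrix (Fin r) (Fin n) ℂ, A.transpose * A = H := by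
  classical
  have : Invertible (2 : ℂ) := invertibleOfNonzero two_ne_zero
  obtain ⟨v, hv⟩ := LinearMap.BilinForm.exists_orthogonal_basis
    (B := Matrix.toBilin' H) ⟨(Matrix.isSymm_toBilin'_iff_isSymm.2 hH).eq⟩
  let w : Module.Basis (Fin n) ℂ (Fin n → ℂ) := v.reindex (finCongr (by simp))
  let P := (Pi.basisFun ℂ (Fin n)).toMatrix w
  let Q := w.toMatrix (Pi.basisFun ℂ (Fin n))
  have hPQ : P * Q = 1 := Module.Basis.toMatrix_mul_toMatrix_flip _ _
  let D : Fin n → ℂ := fun i => (P.transpose * H * P) i i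
  have hD : P.transpose * H * P = Matrix.diagonal D := by
    ext i j
    rcases eq_or_ne i j with rfl | hij
    · simp [D]
    · have h := @hv ((finCongr (by simp)).symm i) ((finCongr (by simp)).symm j)
        (by simpa using hij)
      rw [Matrix.diagonal_apply_ne _ hij, Matrix.mul_assoc]
      simpa [Matrix.toBilin'_apply', Matrix.mul_apply, dotProduct, Matrix.mulVec, P, w,
        Module.Basis.toMatrix_apply] using h
  have hcard : Fintype.card {i // D i ≠ 0} ≤ Fintype.card (Fin r) := by
    rw [← Matrix.rank_diagonal, ← hD, Fintype.card_fin]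
    exact ((Matrix.rank_mul_le_left _ _).trans (Matrix.rank_mul_le_right _ _)).trans hr
  obtain ⟨φ⟩ := Function.Embedding.nonempty_of_card_le hcard
  choose s hs using fun z : ℂ => IsAlgClosed.exists_eq_mul_self z
  let E : Matrix (Fin r) (Fin n) ℂ := Matrix.of fun k i =>
    if h : D i ≠ 0 then (if φ ⟨i, h⟩ = k then s (D i) else 0) else 0
  have hE : E.transpose * E = Matrix.diagonal D := by
    ext i j
    simp only [Matrix.mul_apply, Matrix.transpose_apply, E, Matrix.of_apply]
    by_cases hi : D i ≠ 0
    · by_cases hj : D j ≠ 0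
      · simp only [hi, hj, not_false_eq_true, dite_true, ne_eq, ite_mul, zero_mul, mul_ite,
          mul_zero, Finset.sum_ite_eq, Finset.mem_univ, if_true]
        rcases eq_or_ne i j with rfl | hij
        · simp [← hs]
        · rw [Matrix.diagonal_apply_ne _ hij, if_neg]
          simpa using hij
      · have hij : i ≠ j := by rintro rfl; exact hj hi
        simp [hj, Matrix.diagonal_apply_ne _ hij]
    · have h0 : D i = 0 := by simpa using hi
      rcases eq_or_ne i j with rfl | hij
      · simp [h0]
      · simp [h0, Matrix.diagonal_apply_ne _ hij]
  refine ⟨E * Q, ?_⟩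
  calc (E * Q).transpose * (E * Q) = Q.transpose * (E.transpose * E) * Q := by
        simp only [Matrix.transpose_mul, Matrix.mul_assoc]
    _ = (P * Q).transpose * H * (P * Q) := by
        simp only [hE, ← hD, Matrix.transpose_mul, Matrix.mul_assoc]
    _ = H := by simp [hPQ]

theorem rank_smul_of_ne_zero {n : ℕ} {c : ℂ} (hc : c ≠ 0) (H : Matrix (Fin n) (Fin n) ℂ) :
    (c • H).rank = H.rank :=
  Matrix.rank_smul_of_mem_nonZeroDivisors H (mem_nonZeroDivisors_of_ne_zero hc)

theorem GMVarietyRank_eq (n d r : ℕ) :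
    GMVarietyRank n d r = zClosureV (Set.range fun θ : Option (Fin r) × Fin n → ℂ =>
      (coeffEquiv n d).symm fun b => eval θ (momentMap n d r b)) := by
  rw [GMVarietyRank]
  congr 1
  ext p
  rw [Set.mem_ofPred_eq, Set.mem_range]
  constructor
  · rintro ⟨ℓ, q, hℓ, hq, hrk, hp⟩
    obtain ⟨a, rfl⟩ := linearForm_surjective hℓ
    obtain ⟨A, hA⟩ := exists_transpose_mul_self_eq (r := r)
      (H := (2⁻¹ : ℂ) • hessian n q) ((hessian_symm q).smul _)
      ((rank_smul_of_ne_zero (inv_ne_zero two_ne_zero) _).trans_le hrk)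
    have hq' : ∑ k, linearForm (A k) ^ 2 = q := by
      refine hessian_injective (isHomogeneous_sum_sq_linearForm A) hq ?_
      rw [hessian_sum_sq_linearForm, hA, smul_smul, mul_inv_cancel₀ two_ne_zero, one_smul]
    refine ⟨fun t => t.1.elim (a t.2) fun k => A k t.2, Subtype.ext ?_⟩
    rw [coeffEquiv_symm_eval_momentMap, momentForm_eq_sMoment, hp, ← hq']
    rfl
  · rintro ⟨θ, rfl⟩
    refine ⟨_, _, isHomogeneous_linearForm _, isHomogeneous_sum_sq_linearForm _, ?_,
      (coeffEquiv_symm_eval_momentMap θ).trans (momentForm_eq_sMoment θ)⟩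
    have := hessian_sum_sq_linearForm (Matrix.of fun (k : Fin r) i => θ (some k, i))
    refine le_of_eq_of_le (congrArg Matrix.rank this) ?_
    refine (rank_smul_of_ne_zero two_ne_zero _).trans_le ((Matrix.rank_mul_le_right _ _).trans ?_)
    simpa using Matrix.rank_le_card_height (Matrix.of fun (k : Fin r) i => θ (some k, i))

/-! ### Linear changes of variables -/

/-- The substitution of the linear forms given by the rows of a matrix. -/
def linearSubst {R : Type*} [CommRing R] {n : ℕ} (g : Matrix (Fin n) (Fin n) R) :
    MvPolynomial (Fin n) R →ₐ[R] MvPolynomial (Fin n) R :=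
  aeval fun i => linearForm (g i)

theorem linearSubst_linearForm {n : ℕ} (g : Matrix (Fin n) (Fin n) ℂ) (a : Fin n → ℂ) :
    linearSubst g (linearForm a) = linearForm fun i => ∑ j, a j * g j i := by
  rw [linearSubst, linearForm, map_sum]
  simp only [map_mul, algHom_C, aeval_X, algebraMap_eq, linearForm, map_sum, Finset.mul_sum,
    Finset.sum_mul, mul_assoc]
  exact Finset.sum_comm

/-- The action of a matrix on forms of degree `d` in terms of coefficients. -/
def coeffAction {n : ℕ} (d : ℕ) (g : Matrix (Fin n) (Fin n) ℂ) :
    (Exponent n d → ℂ) →ₗ[ℂ] (Exponent n d → ℂ) :=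
  LinearMap.pi fun b => lcoeff ℂ b.1 ∘ₗ (linearSubst g).toLinearMap ∘ₗ ofCoeffs n d

theorem coeffAction_apply {n d : ℕ} (g : Matrix (Fin n) (Fin n) ℂ) (v : Exponent n d → ℂ)
    (b : Exponent n d) :
    coeffAction d g v b = coeff b.1 (linearSubst g (ofCoeffs n d v)) := rfl

/-- The action of a matrix on the parameters of the Gaussian moment variety. -/
def paramAction {n : ℕ} (r : ℕ) (g : Matrix (Fin n) (Fin n) ℂ) :
    (Option (Fin r) × Fin n → ℂ) →ₗ[ℂ] (Option (Fin r) × Fin n → ℂ) :=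
  LinearMap.pi fun t => ∑ j, g j t.2 • LinearMap.proj (t.1, j)

theorem paramAction_apply {n r : ℕ} (g : Matrix (Fin n) (Fin n) ℂ)
    (θ : Option (Fin r) × Fin n → ℂ) (t : Option (Fin r) × Fin n) :
    paramAction r g θ t = ∑ j, θ (t.1, j) * g j t.2 := by
  simp [paramAction, mul_comm]

theorem paramAction_paramAction {n r : ℕ} (g h : Matrix (Fin n) (Fin n) ℂ)
    (θ : Option (Fin r) × Fin n → ℂ) :
    paramAction r g (paramAction r h θ) = paramAction r (h * g) θ := by
  ext t
  simp only [paramAction_apply, Matrix.mul_apply, Finset.mul_sum, Finset.sum_mul, mul_assoc]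
  exact Finset.sum_comm

theorem paramAction_one {n r : ℕ} (θ : Option (Fin r) × Fin n → ℂ) :
    paramAction r 1 θ = θ := by
  ext t
  simp [paramAction_apply, Matrix.one_apply]

theorem momentForm_paramAction {n d r : ℕ} (g : Matrix (Fin n) (Fin n) ℂ)
    (θ : Option (Fin r) × Fin n → ℂ) :
    momentForm d r (paramAction r g θ) = linearSubst g (momentForm d r θ) := by
  simp only [momentForm, map_sum, map_smul, map_mul, map_pow, linearSubst_linearForm,
    paramAction_apply]

theorem eval_momentMap_paramAction {n d r : ℕ} (g : Matrix (Fin n) (Fin n) ℂ)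
    (θ : Option (Fin r) × Fin n → ℂ) :
    (fun b => eval (paramAction r g θ) (momentMap n d r b)) =
      coeffAction d g fun b => eval θ (momentMap n d r b) := by
  ext b
  simp only [coeffAction_apply, eval_momentMap]
  rw [ofCoeffs_coeff (isHomogeneous_momentForm θ), momentForm_paramAction]

theorem jacobianAt_momentMap_comp_paramAction {n d r : ℕ} (g : Matrix (Fin n) (Fin n) ℂ)
    (θ : Option (Fin r) × Fin n → ℂ) :
    jacobianAt (momentMap n d r) (paramAction r g θ) ∘ₗ paramAction r g =
      coeffAction d g ∘ₗ jacobianAt (momentMap n d r) θ := by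
  have h1 := (hasFDerivAt_eval_pi (momentMap n d r) (paramAction r g θ)).comp θ
    (LinearMap.toContinuousLinearMap (paramAction r g)).hasFDerivAt
  have h2 := (LinearMap.toContinuousLinearMap (coeffAction d g)).hasFDerivAt.comp θ
    (hasFDerivAt_eval_pi (momentMap n d r) θ)
  have h3 := h1.congr_of_eventuallyEq (f₁ := _) (Filter.Eventually.of_forall fun θ' =>
    (eval_momentMap_paramAction g θ').symm)
  ext u b
  simpa using congr_fun (DFunLike.congr_fun (h3.unique h2) (Pi.single u 1)) b

theorem isTangentSymmetry_coeffAction {n d r : ℕ} {g : Matrix (Fin n) (Fin n) ℂ}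
    (hg : g.det ≠ 0) : IsTangentSymmetry (momentMap n d r) (coeffAction d g) := by
  have hu : IsUnit g.det := isUnit_iff_ne_zero.2 hg
  have heval : ∀ θ : Option (Fin r) × Fin n → ℂ, (fun t : Option (Fin r) × Fin n =>
      eval θ (∑ j, X (t.1, j) * C (g⁻¹ j t.2))) = paramAction r g⁻¹ θ := fun θ => by
    ext t
    simp [paramAction_apply]
  refine ⟨fun t => ∑ j, X (t.1, j) * C (g⁻¹ j t.2), fun θ => ⟨paramAction r g θ, ?_⟩, fun θ => ?_⟩
  · simp only [heval]
    rw [paramAction_paramAction, Matrix.mul_nonsing_inv _ hu, paramAction_one]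
  · rw [heval]
    have h := jacobianAt_momentMap_comp_paramAction (d := d) g (paramAction r g⁻¹ θ)
    rw [paramAction_paramAction, Matrix.nonsing_inv_mul _ hu, paramAction_one] at h
    rw [← LinearMap.range_comp, ← h]
    exact LinearMap.range_comp_le_range _ _

/-! ### Irreducibility of the space of forms -/

theorem map_linearSubst {n : ℕ} (x : Fin n × Fin n → ℂ) (p : MvPolynomial (Fin n) ℂ) :
    map (eval x) (linearSubst (Matrix.mvPolynomialX (Fin n) (Fin n) ℂ) (map C p)) =
      linearSubst (Matrix.of fun i j => x (i, j)) p := by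
  induction p using MvPolynomial.induction_on with
  | C a => simp [linearSubst]
  | add p q hp hq => simp only [map_add, hp, hq]
  | mul_X p i hp =>
    simp only [map_mul, hp]
    simp [linearSubst, linearForm]

theorem linearSubst_vecMulVec {n d : ℕ} {p : MvPolynomial (Fin n) ℂ} (hp : p.IsHomogeneous d)
    (c a : Fin n → ℂ) :
    linearSubst (Matrix.vecMulVec c a) p = C (eval c p) * linearForm a ^ d := by
  have h : ∀ i, linearForm (Matrix.vecMulVec c a i) = C (c i) * linearForm a := fun i => by
    simp [linearForm, Matrix.vecMulVec_apply, Finset.mul_sum, mul_assoc]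
  rw [linearSubst, aeval_def, eval₂_eq', eval_eq', map_sum, Finset.sum_mul]
  refine Finset.sum_congr rfl fun b hb => ?_
  have hb' : ∑ i, b i = d := by
    rw [← Finsupp.degree_eq_sum]
    by_contra h0
    exact mem_support_iff.1 hb (hp.coeff_eq_zero h0)
  simp only [h, mul_pow, Finset.prod_mul_distrib, Finset.prod_pow_eq_pow_sum, hb', map_mul,
    map_prod, map_pow, algebraMap_eq, mul_assoc]

theorem coeff_linearForm_pow {n d : ℕ} (a : Fin n → ℂ) (b : Exponent n d) :
    coeff b.1 (linearForm a ^ d) = b.1.multinomial * ∏ i, a i ^ b.1 i := by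
  have hb : b.1.sum (fun _ m => m) = d := mem_finsuppAntidiag_univ_iff.1 b.2
  simp only [linearForm, ← smul_eq_C_mul]
  rw [coeff_linearCombination_X_pow_of_fintype, if_pos hb, Finsupp.prod_fintype _ _ (by simp)]

/-- The orbit of a nonzero form under invertible linear substitutions spans the space of
forms. -/
theorem span_coeffAction_eq_top {n d : ℕ} {v : Exponent n d → ℂ} (hv : v ≠ 0) :
    Submodule.span ℂ {w | ∃ g : Matrix (Fin n) (Fin n) ℂ, g.det ≠ 0 ∧ coeffAction d g v = w} =
      ⊤ := by
  classical
  by_contra hne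
  obtain ⟨φ, hφ, hker⟩ := Submodule.exists_le_ker_of_lt_top _ (lt_top_iff_ne_top.2 hne)
  have hvan : ∀ g : Matrix (Fin n) (Fin n) ℂ, g.det ≠ 0 → φ (coeffAction d g v) = 0 := fun g hg =>
    hker (Submodule.subset_span ⟨g, hg, rfl⟩)
  have hφ_apply : ∀ w, φ w = ∑ b, w b * φ (Pi.single b 1) := fun w => by
    conv_lhs => rw [← (Pi.basisFun ℂ (Exponent n d)).sum_repr w]
    simp
  let G : MvPolynomial (Fin n × Fin n) ℂ := ∑ b : Exponent n d, coeff b.1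
    (linearSubst (Matrix.mvPolynomialX (Fin n) (Fin n) ℂ) (map C (ofCoeffs n d v))) *
      C (φ (Pi.single b 1))
  have hG : ∀ x, eval x G = φ (coeffAction d (Matrix.of fun i j => x (i, j)) v) := fun x => by
    rw [hφ_apply, map_sum]
    refine Finset.sum_congr rfl fun b _ => ?_
    rw [map_mul, eval_C, coeffAction_apply, ← map_linearSubst, coeff_map]
  have hG0 : G = 0 := by
    refine eq_zero_of_eventually_eval_eq_zero (eventually_genericFilter.2
      ⟨_, Matrix.det_mvPolynomialX_ne_zero (Fin n) ℂ, fun x hx => ?_⟩)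
    rw [hG]
    refine hvan _ ?_
    rw [RingHom.map_det] at hx
    convert hx using 2
    ext i j
    simp
  have hp : ofCoeffs n d v ≠ 0 := fun h => hv (by ext b; rw [← coeff_ofCoeffs v b, h]; simp)
  obtain ⟨c, hc⟩ := exists_eval_ne_zero hp
  have hpow : (∑ b : Exponent n d, monomial b.1 (b.1.multinomial * φ (Pi.single b 1))) = 0 := by
    refine MvPolynomial.funext fun a => ?_
    have h := hG fun t => c t.1 * a t.2
    rw [hG0, map_zero] at h
    have hmat : (Matrix.of fun i j => c i * a j) = Matrix.vecMulVec c a := rfl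
    simp only [hmat, hφ_apply (coeffAction _ _ _), coeffAction_apply,
      linearSubst_vecMulVec (isHomogeneous_ofCoeffs v), coeff_C_mul, coeff_linearForm_pow,
      mul_assoc, ← Finset.mul_sum] at h
    rw [map_zero, map_sum, ← (mul_eq_zero.1 h.symm).resolve_left hc]
    refine Finset.sum_congr rfl fun b _ => ?_
    rw [eval_monomial, Finsupp.prod_fintype _ _ (by simp)]
    ring
  refine hφ (LinearMap.ext fun w => ?_)
  rw [hφ_apply, LinearMap.zero_apply]
  refine Finset.sum_eq_zero fun b _ => ?_
  have h := congrArg (coeff b.1) hpow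
  rw [← ofCoeffs_eq_sum, coeff_ofCoeffs, coeff_zero] at h
  rw [(mul_eq_zero.1 h).resolve_left (Nat.cast_ne_zero.2 (Nat.multinomial_pos _ _).ne'), mul_zero]

theorem span_isTangentSymmetry_eq_top {n d r : ℕ} {v : Exponent n d → ℂ} (hv : v ≠ 0) :
    Submodule.span ℂ {w | ∃ S, IsTangentSymmetry (momentMap n d r) S ∧ S v = w} = ⊤ := by
  rw [eq_top_iff, ← span_coeffAction_eq_top hv]
  refine Submodule.span_mono ?_
  rintro w ⟨g, hg, hw⟩
  exact ⟨_, isTangentSymmetry_coeffAction hg, hw⟩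

/-! ### The upper bound on the dimension -/

/-- The skew-symmetric matrix with given entries below the diagonal. -/
def skewMatrix (r : ℕ) : ((Σ k : Fin r, Fin k) → ℂ) →ₗ[ℂ] Matrix (Fin r) (Fin r) ℂ where
  toFun c := Matrix.of fun k j => (if h : j < k then c ⟨k, ⟨j, h⟩⟩ else 0) -
    (if h : k < j then c ⟨j, ⟨k, h⟩⟩ else 0)
  map_add' c c' := by
    ext k j
    simp only [Matrix.of_apply, Matrix.add_apply, Pi.add_apply]
    split_ifs <;> ring
  map_smul' a c := by
    ext k j
    simp only [Matrix.of_apply, Matrix.smul_apply, Pi.smul_apply, RingHom.id_apply, smul_eq_mul]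
    split_ifs <;> ring

theorem skewMatrix_transpose {r : ℕ} (c : (Σ k : Fin r, Fin k) → ℂ) :
    (skewMatrix r c).transpose = -skewMatrix r c := by
  ext k j
  simp [skewMatrix]

theorem skewMatrix_injective (r : ℕ) : Function.Injective (skewMatrix r) := by
  refine (injective_iff_map_eq_zero _).2 fun c hc => ?_
  ext ⟨k, j⟩
  have hj : (⟨j, j.2.trans k.2⟩ : Fin r) < k := j.2
  have h := congr_fun₂ hc k ⟨j, j.2.trans k.2⟩
  simpa [skewMatrix, hj, hj.not_gt] using h

theorem card_sigma_fin (r : ℕ) : Fintype.card (Σ k : Fin r, Fin k) = r * (r - 1) / 2 := by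
  rw [Fintype.card_sigma, ← Finset.sum_range_id, Finset.sum_range]
  simp

/-- The infinitesimal action of matrices on the quadratic part of the parameters. -/
def quadraticRotation {n r : ℕ} (θ : Option (Fin r) × Fin n → ℂ) :
    Matrix (Fin r) (Fin r) ℂ →ₗ[ℂ] (Option (Fin r) × Fin n → ℂ) where
  toFun A t := t.1.elim 0 fun k => ∑ j, A k j * θ (some j, t.2)
  map_add' A A' := by
    ext ⟨_ | k, i⟩ <;> simp [add_mul, Finset.sum_add_distrib]
  map_smul' a A := by
    ext ⟨_ | k, i⟩ <;> simp [Finset.mul_sum, mul_assoc]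

theorem linearForm_add_mul {n : ℕ} (a b : Fin n → ℂ) (s : ℂ) :
    linearForm (fun i => a i + s * b i) = linearForm a + C s * linearForm b := by
  simp [linearForm, add_mul, Finset.sum_add_distrib, Finset.mul_sum, mul_assoc]

theorem linearForm_rotation {n r : ℕ} (θ : Option (Fin r) × Fin n → ℂ)
    (A : Matrix (Fin r) (Fin r) ℂ) (k : Fin r) :
    linearForm (fun i => quadraticRotation θ A (some k, i)) =
      ∑ j, C (A k j) * linearForm fun i => θ (some j, i) := by
  simp only [quadraticRotation, LinearMap.coe_mk, AddHom.coe_mk, Option.elim_some, linearForm,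
    map_sum, map_mul, Finset.sum_mul, Finset.mul_sum, mul_assoc]
  exact Finset.sum_comm

theorem sum_sq_linearForm_rotation {n r : ℕ} (θ : Option (Fin r) × Fin n → ℂ)
    {A : Matrix (Fin r) (Fin r) ℂ} (hA : A.transpose = -A) (s : ℂ) :
    ∑ k, linearForm (fun i => θ (some k, i) + s * quadraticRotation θ A (some k, i)) ^ 2 =
      ∑ k, linearForm (fun i => θ (some k, i)) ^ 2 +
        C (s ^ 2) * ∑ k, linearForm (fun i => quadraticRotation θ A (some k, i)) ^ 2 := by
  have hcross : ∑ k, linearForm (fun i => θ (some k, i)) *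
      linearForm (fun i => quadraticRotation θ A (some k, i)) = 0 := by
    simp only [linearForm_rotation, Finset.mul_sum]
    refine self_eq_neg.1 ?_
    conv_lhs => rw [Finset.sum_comm]
    simp only [← Finset.sum_neg_distrib]
    refine Finset.sum_congr rfl fun k _ => Finset.sum_congr rfl fun j _ => ?_
    have h : A j k = -A k j := congr_fun₂ hA k j
    rw [h, map_neg]
    ring
  simp only [linearForm_add_mul]
  calc _ = ∑ k, (linearForm (fun i => θ (some k, i)) ^ 2 + 2 * C s *
        (linearForm (fun i => θ (some k, i)) *
          linearForm (fun i => quadraticRotation θ A (some k, i))) +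
        C (s ^ 2) * linearForm (fun i => quadraticRotation θ A (some k, i)) ^ 2) :=
        Finset.sum_congr rfl fun k _ => by rw [map_pow]; ring
    _ = _ := by
      rw [Finset.sum_add_distrib, Finset.sum_add_distrib, ← Finset.mul_sum, ← Finset.mul_sum,
        hcross, mul_zero, add_zero]

theorem momentForm_add_rotation {n d r : ℕ} (θ : Option (Fin r) × Fin n → ℂ)
    {A : Matrix (Fin r) (Fin r) ℂ} (hA : A.transpose = -A) (s : ℂ) :
    momentForm d r (θ + (-s) • quadraticRotation θ A) =
      momentForm d r (θ + s • quadraticRotation θ A) := by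
  have hnone : ∀ i, quadraticRotation θ A (none, i) = 0 := fun i => rfl
  simp only [momentForm, Pi.add_apply, Pi.smul_apply, smul_eq_mul, hnone, mul_zero,
    sum_sq_linearForm_rotation θ hA, neg_sq]

theorem jacobianAt_momentMap_rotation {n d r : ℕ} (θ : Option (Fin r) × Fin n → ℂ)
    {A : Matrix (Fin r) (Fin r) ℂ} (hA : A.transpose = -A) :
    jacobianAt (momentMap n d r) θ (quadraticRotation θ A) = 0 := by
  have hline : ∀ u : Option (Fin r) × Fin n → ℂ,
      HasDerivAt (fun (s : ℂ) b => eval (θ + s • u) (momentMap n d r b))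
        (jacobianAt (momentMap n d r) θ u) 0 := fun u => by
    have h1 : HasDerivAt (fun s : ℂ => θ + s • u) u 0 := by
      simpa using ((hasDerivAt_id (0 : ℂ)).smul_const u).const_add θ
    have h2 := hasFDerivAt_eval_pi (momentMap n d r) (θ + (0 : ℂ) • u)
    rw [zero_smul, add_zero] at h2
    exact HasFDerivAt.comp_hasDerivAt_of_eq (0 : ℂ) h2 h1 (by simp)
  have h1 := hline (quadraticRotation θ A)
  have h2 := hline (-quadraticRotation θ A)
  have h : (fun (s : ℂ) b => eval (θ + s • -quadraticRotation θ A) (momentMap n d r b)) =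
      fun (s : ℂ) b => eval (θ + s • quadraticRotation θ A) (momentMap n d r b) := by
    ext s b
    rw [eval_momentMap, eval_momentMap, smul_neg, ← neg_smul, momentForm_add_rotation θ hA]
  rw [h] at h2
  have := h1.unique h2
  rw [map_neg] at this
  exact self_eq_neg.1 this

theorem genericRank_momentMap_le {n d r : ℕ} (hr : r ≤ n) :
    genericRank (momentMap n d r) ≤ (r + 1) * n - r * (r - 1) / 2 := by
  classical
  let P : Matrix (Fin r) (Fin r) (MvPolynomial (Option (Fin r) × Fin n) ℂ) :=
    Matrix.of fun k j => X (some k, Fin.castLE hr j)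
  have hP : ∀ θ, eval θ P.det = (Matrix.of fun k j => θ (some k, Fin.castLE hr j)).det :=
    fun θ => by
      rw [RingHom.map_det]
      congr 1
      ext k j
      simp [P]
  have hgen : ∀ᶠ θ in genericFilter _, eval θ P.det ≠ 0 := by
    refine eventually_genericFilter_of_eval_ne_zero
      (x₀ := fun t => t.1.elim 0 fun k => if Fin.castLE hr k = t.2 then 1 else 0) ?_
    rw [hP]
    have h1 : (Matrix.of fun k j : Fin r => (if Fin.castLE hr k = Fin.castLE hr j then 1 else 0)) =
        (1 : Matrix (Fin r) (Fin r) ℂ) := by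
      ext k j
      simp [Matrix.one_apply]
    simp only [Option.elim_some, h1, Matrix.det_one]
    exact one_ne_zero
  obtain ⟨θ, hθ, hdet⟩ := ((eventually_finrank_range_jacobianAt (momentMap n d r)).and hgen).exists
  rw [hP] at hdet
  have hinj : Function.Injective (quadraticRotation θ) := by
    refine (injective_iff_map_eq_zero _).2 fun A hA => ?_
    have hmul : A * (Matrix.of fun k j => θ (some k, Fin.castLE hr j)) = 0 := by
      ext k j
      simpa [quadraticRotation, Matrix.mul_apply] using congr_fun hA (some k, Fin.castLE hr j)
    have hu := isUnit_iff_ne_zero.2 hdet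
    rw [← Matrix.mul_one A, ← Matrix.mul_nonsing_inv _ hu, ← Matrix.mul_assoc, hmul,
      Matrix.zero_mul]
  let K := LinearMap.ker (jacobianAt (momentMap n d r) θ)
  let Ψ : ((Σ k : Fin r, Fin k) → ℂ) →ₗ[ℂ] K := (quadraticRotation θ ∘ₗ skewMatrix r).codRestrict K
    fun c => jacobianAt_momentMap_rotation θ (skewMatrix_transpose c)
  have hΨ : Function.Injective Ψ := fun c c' h =>
    skewMatrix_injective r (hinj (congrArg Subtype.val h))
  have hker := LinearMap.finrank_le_finrank_of_injective hΨ
  have hrn := LinearMap.finrank_range_add_finrank_ker (jacobianAt (momentMap n d r) θ)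
  rw [Module.finrank_fintype_fun_eq_card, card_sigma_fin] at hker
  rw [hθ, Module.finrank_fintype_fun_eq_card, Fintype.card_prod, Fintype.card_option,
    Fintype.card_fin, Fintype.card_fin] at hrn
  change _ + Module.finrank ℂ K = _ at hrn
  omega

theorem stmt_16 (n d r : ℕ) (hn : 1 ≤ n) (hd : 3 ≤ d) (hr : r ≤ n)
    (M : ℕ) (hM : M = (r + 1) * n - r * (r - 1) / 2) :
    ∃ N : ℕ, zDimV (GMVarietyRank n d r) = (N : WithBot ℕ∞) ∧ N ≤ M ∧
    (∀ m : ℕ, 1 ≤ m → N * (m + N) ≤ Nat.choose (n + d - 1) d →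
      zDimV (secantV m (GMVarietyRank n d r)) = ((m * N : ℕ) : WithBot ℕ∞)) ∧
    (∀ m : ℕ, 1 ≤ m → Nat.choose (n + d - 1) d + N ^ 2 ≤ m * N →
      secantV m (GMVarietyRank n d r) = Set.univ) := by
  have hsec := secantRank_eq_mul_and_eq_card (momentMap n d r)
    fun v hv => span_isTangentSymmetry_eq_top hv
  rw [GMVarietyRank_eq, ← card_exponent]
  refine ⟨genericRank (momentMap n d r), zDimV_zClosureV_range _ _,
    hM ▸ genericRank_momentMap_le hr, fun m _ hm => ?_, fun m _ hm => ?_⟩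
  · rw [secantV_zClosureV_range, zDimV_zClosureV_range, ← (hsec m).1 hm, secantRank]
  · rw [secantV_zClosureV_range]
    exact zClosureV_range_eq_univ _ _ ((hsec m).2 hm)
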